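/- arXiv:math/0112186 — 3 statements merged into one kernel-verified Lean document; each statement's English description precedes it below -/
import Mathlib

section
/- Let X ⊆ ℙ^1 × ℙ^1 be a finite set of distinct points, let P_1 ∈ π_1(X), let L_{P_1} be the degree-(1,0) form vanishing at all points with first coordinate P_1, set X_{P_1} = π_1^{-1}(P_1) ∩ X and Z = X \ X_{P_1}, and assume π_2(X_{P_1}) = π_2(X) = {Q_1,…,Q_r}. Let F = L_{Q_1}L_{Q_2}⋯L_{Q_r}, where L_{Q_i} is the degree-(0,1) form vanishing at all points with second coordinate Q_i. Then I_X = L_{P_1}·I_Z + (F). -/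
open MvPolynomial

noncomputable section

namespace PaperMP

variable (K : Type) [Field K] [IsAlgClosed K] [CharZero K]
variable (k : ℕ) (n : Fin k → ℕ)

/-- Index type of the variables `x_{i,j}`, `1 ≤ i ≤ k`, `0 ≤ j ≤ n i`. -/
abbrev Sig := Σ i : Fin k, Fin (n i + 1)

/-- The `ℕ^k`-graded polynomial ring `R`. -/
abbrev MPRing := MvPolynomial (Sig k n) K

/-- The grading of `R`: `deg x_{i,j} = e_i`. -/
def wt : Sig k n → (Fin k → ℕ) := fun p => Pi.single p.1 1

/-- A point of `ℙ^{n_1} × ⋯ × ℙ^{n_k}`. -/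
abbrev MPPoint := ∀ i : Fin k, Projectivization K (Fin (n i + 1) → K)

/-- The affine cone over a point of multiprojective space. -/
def cone (P : MPPoint K k n) : Set (Sig k n → K) :=
  {x | ∀ i : Fin k, ∃ c : K, (fun j => x ⟨i, j⟩) = c • (P i).rep}

/-- Vanishing ideal of a set of points of affine space. -/
def vanishingIdeal (T : Set (Sig k n → K)) : Ideal (MPRing K k n) :=
  ⨅ x ∈ T, RingHom.ker (MvPolynomial.eval x)

/-- The (prime) ideal `I_P` of a point of multiprojective space. -/
def idealOfPoint (P : MPPoint K k n) : Ideal (MPRing K k n) :=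
  vanishingIdeal K k n (cone K k n P)

/-- The ideal `I_X` of a set of points of multiprojective space. -/
def idealOfSet (X : Set (MPPoint K k n)) : Ideal (MPRing K k n) :=
  ⨅ P ∈ X, idealOfPoint K k n P

/-- The Hilbert function of `R/I` in multidegree `d`. -/
def hilb (I : Ideal (MPRing K k n)) (d : Fin k → ℕ) : ℕ :=
  Module.finrank K ((weightedHomogeneousSubmodule K (wt k n) d).map
    (Ideal.Quotient.mkₐ K I).toLinearMap)

/-- The irrelevant maximal ideal `m = (x_{1,0},…,x_{k,n_k})`. -/
def maxIdeal : Ideal (MPRing K k n) :=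
  Ideal.span (Set.range (MvPolynomial.X : Sig k n → MPRing K k n))

/-- `L` is a regular sequence modulo `I`:  `(I,L) ⊆ m`, and each entry is a
non-zero divisor modulo `I` together with the previous entries. -/
def IsRegSeqMod (I : Ideal (MPRing K k n)) (L : List (MPRing K k n)) : Prop :=
  I ⊔ Ideal.span {f | f ∈ L} ≤ maxIdeal K k n ∧
  ∀ i : Fin L.length, ∀ G : MPRing K k n,
    L.get i * G ∈ I ⊔ Ideal.span {f | f ∈ L.take i} →
      G ∈ I ⊔ Ideal.span {f | f ∈ L.take i}

/-- `depth R/I = l`: `l` is the length of a maximal regular sequence modulo `I`. -/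
def hasDepth (I : Ideal (MPRing K k n)) (l : ℕ) : Prop :=
  IsGreatest {r : ℕ | ∃ L : List (MPRing K k n), L.length = r ∧ IsRegSeqMod K k n I L} l

/-- `X` is arithmetically Cohen–Macaulay: `depth R/I_X = K-dim R/I_X = k`. -/
def IsACM (X : Set (MPPoint K k n)) : Prop :=
  hasDepth K k n (idealOfSet K k n X) k

/-! ### The first difference function -/

/-- Extend `H : ℕ^k → ℕ` by zero outside ℕ^k. -/
def extNeg (H : (Fin k → ℕ) → ℕ) (j : Fin k → ℤ) : ℤ :=
  if ∀ i, 0 ≤ j i then H (fun i => (j i).toNat) else 0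

/-- The first difference function `ΔH` of a numerical function `H : ℕ^k → ℕ`. -/
def delta (H : (Fin k → ℕ) → ℕ) (d : Fin k → ℕ) : ℤ :=
  ∑ l : Fin k → Fin 2, (-1 : ℤ) ^ (∑ i, (l i : ℕ)) *
    extNeg k H (fun i => (d i : ℤ) - (l i : ℕ))

/-! ### The ring `S = k[x_{1,1},…,x_{k,n_k}]` -/

/-- Index type of the variables `x_{i,j}`, `1 ≤ i ≤ k`, `1 ≤ j ≤ n i`. -/
abbrev SigS := Σ i : Fin k, Fin (n i)

/-- The `ℕ^k`-graded polynomial ring `S`. -/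
abbrev SRing := MvPolynomial (SigS k n) K

/-- The grading of `S`: `deg x_{i,j} = e_i`. -/
def wtS : SigS k n → (Fin k → ℕ) := fun p => Pi.single p.1 1

/-- The Hilbert function of `S/J` in multidegree `d`. -/
def hilbS (J : Ideal (SRing K k n)) (d : Fin k → ℕ) : ℕ :=
  Module.finrank K ((weightedHomogeneousSubmodule K (wtS k n) d).map
    (Ideal.Quotient.mkₐ K J).toLinearMap)

/-- `J` is an `ℕ^k`-homogeneous ideal of `S`. -/
def IsHomogIdealS (J : Ideal (SRing K k n)) : Prop :=
  ∀ f ∈ J, ∀ d : Fin k → ℕ, weightedHomogeneousComponent (wtS k n) d f ∈ J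

/-- `J` is an artinian ideal of `S`: `√J = (x_{1,1},…,x_{k,n_k})`. -/
def IsArtinianIdealS (J : Ideal (SRing K k n)) : Prop :=
  J.radical = Ideal.span (Set.range (MvPolynomial.X : SigS k n → SRing K k n))

/-! ### The ring `k[x_1,…,x_k]`, with `deg x_i = e_i` -/

abbrev TRing := MvPolynomial (Fin k) K

/-- The grading: `deg x_i = e_i`. -/
def wtT : Fin k → (Fin k → ℕ) := fun i => Pi.single i 1

/-- The Hilbert function of `k[x_1,…,x_k]/I` in multidegree `d`. -/
def hilbT (I : Ideal (TRing K k)) (d : Fin k → ℕ) : ℕ :=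
  Module.finrank K ((weightedHomogeneousSubmodule K (wtT k) d).map
    (Ideal.Quotient.mkₐ K I).toLinearMap)

/-- `I` is an `ℕ^k`-homogeneous ideal of `k[x_1,…,x_k]`. -/
def IsHomogIdealT (I : Ideal (TRing K k)) : Prop :=
  ∀ f ∈ I, ∀ d : Fin k → ℕ, weightedHomogeneousComponent (wtT k) d f ∈ I

/-- `I` is an artinian ideal of `k[x_1,…,x_k]`: `√I = (x_1,…,x_k)`. -/
def IsArtinianIdealT (I : Ideal (TRing K k)) : Prop :=
  I.radical = Ideal.span (Set.range (MvPolynomial.X : Fin k → TRing K k))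

/-! ### Lifting monomial ideals -/

/-- The lift `m̄ = ∏_{i,j} ∏_{l=1}^{a_{i,j}} (x_{i,j} - (l-1) x_{i,0})` of the monomial
of `S` with exponent vector `b`, via the lifting matrix `𝒜`. -/
def liftMonomial (b : SigS k n →₀ ℕ) : MPRing K k n :=
  ∏ p ∈ b.support, ∏ l ∈ Finset.range (b p),
    (MvPolynomial.X (⟨p.1, p.2.succ⟩ : Sig k n) - (l : MPRing K k n) * MvPolynomial.X ⟨p.1, 0⟩)

/-- `J` is a monomial ideal of `S`. -/
def IsMonomialIdeal (J : Ideal (SRing K k n)) : Prop :=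
  ∃ A : Set (SigS k n →₀ ℕ), J = Ideal.span ((fun b => (monomial b (1 : K) : SRing K k n)) '' A)

/-- The exponent vectors of the minimal monomial generators of a monomial ideal `J ⊆ S`. -/
def minGens (J : Ideal (SRing K k n)) : Set (SigS k n →₀ ℕ) :=
  {b | (monomial b (1 : K) : SRing K k n) ∈ J ∧
    ∀ b' : SigS k n →₀ ℕ, b' ≤ b → b' ≠ b → (monomial b' (1 : K) : SRing K k n) ∉ J}

/-- The lift to `R` of a monomial ideal `J ⊆ S`, generated by the lifts of the
minimal monomial generators of `J`. -/
def liftIdeal (J : Ideal (SRing K k n)) : Ideal (MPRing K k n) :=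
  Ideal.span (liftMonomial K k n '' minGens K k n J)

/-- The projection `R → S ≅ R/(x_{1,0},…,x_{k,0})` sending `x_{i,0} ↦ 0` and
`x_{i,j} ↦ x_{i,j}` for `j ≥ 1`. -/
def projToS : MPRing K k n →ₐ[K] SRing K k n :=
  aeval (fun p : Sig k n =>
    if h : p.2 = 0 then 0 else MvPolynomial.X (⟨p.1, p.2.pred h⟩ : SigS k n))

/-- The point `[1:b_{i,1}:⋯:b_{i,n_i}] × ⋯` of multiprojective space associated to the
exponent vector `b` of a monomial of `S`. -/
def monToPoint (b : SigS k n →₀ ℕ) : MPPoint K k n := fun i =>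
  Projectivization.mk K
    (fun j : Fin (n i + 1) => if h : j = 0 then 1 else ((b ⟨i, j.pred h⟩ : ℕ) : K))
    (fun hc => by simpa using congrFun hc 0)

/-! ### Partitions -/

/-- `lam` is a partition: positive non-increasing entries. -/
def IsPartition {t : ℕ} (lam : Fin t → ℕ) : Prop :=
  (∀ j, 0 < lam j) ∧ Antitone lam

/-- `lam` is a partition of `s`. -/
def IsPartitionOf (s : ℕ) {t : ℕ} (lam : Fin t → ℕ) : Prop :=
  IsPartition lam ∧ ∑ j, lam j = s

/-- The `(i+1)`-st entry `λ*_{i+1} = #{j : λ_j ≥ i+1}` of the conjugate partition. -/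
def conjEntry {t : ℕ} (lam : Fin t → ℕ) (i : ℕ) : ℕ :=
  (Finset.univ.filter fun j : Fin t => i + 1 ≤ lam j).card

/-- `β` is the conjugate partition `α*` of `α`. -/
def IsConjugateOf {t m : ℕ} (α : Fin t → ℕ) (β : Fin m → ℕ) : Prop :=
  (∀ i : Fin m, β i = conjEntry α i) ∧ ∀ i : ℕ, m ≤ i → conjEntry α i = 0

/-! ### `ℙ^1 × ℙ^1` -/

/-- A point of `ℙ^1`. -/
abbrev Proj1 := Projectivization K (Fin 2 → K)

/-- A point of `ℙ^1 × ℙ^1`. -/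
abbrev Pt2 := MPPoint K 2 (fun _ => 1)

/-- The coordinate ring of `ℙ^1 × ℙ^1`. -/
abbrev R2 := MPRing K 2 (fun _ => 1)

/-- `P` enumerates the distinct first coordinates of `X` and `α` lists the sizes of the
corresponding fibers, in non-increasing order; so `α = α_X`. -/
def IsAlphaLabel (X : Set (Pt2 K)) {t : ℕ} (P : Fin t → Proj1 K) (α : Fin t → ℕ) : Prop :=
  Function.Injective P ∧ (Set.range P = (fun Z : Pt2 K => Z 0) '' X) ∧
  (∀ i, α i = Set.ncard {Z | Z ∈ X ∧ Z 0 = P i}) ∧ Antitone α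

/-- `Q` enumerates the distinct second coordinates of `X` and `β` lists the sizes of the
corresponding fibers, in non-increasing order; so `β = β_X`. -/
def IsBetaLabel (X : Set (Pt2 K)) {r : ℕ} (Q : Fin r → Proj1 K) (β : Fin r → ℕ) : Prop :=
  Function.Injective Q ∧ (Set.range Q = (fun Z : Pt2 K => Z 1) '' X) ∧
  (∀ i, β i = Set.ncard {Z | Z ∈ X ∧ Z 1 = Q i}) ∧ Antitone β

/-- `α = α_X`. -/
def IsAlphaPartition (X : Set (Pt2 K)) {t : ℕ} (α : Fin t → ℕ) : Prop :=
  ∃ P : Fin t → Proj1 K, IsAlphaLabel K X P α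

/-- `β = β_X`. -/
def IsBetaPartition (X : Set (Pt2 K)) {r : ℕ} (β : Fin r → ℕ) : Prop :=
  ∃ Q : Fin r → Proj1 K, IsBetaLabel K X Q β

/-- `F` is "the" form of degree `(1,0)` vanishing at all points of `ℙ^1 × ℙ^1` whose
first coordinate is `P`. -/
def IsForm1Of (P : Proj1 K) (F : R2 K) : Prop :=
  IsWeightedHomogeneous (wt 2 (fun _ => 1)) F (Pi.single 0 1) ∧ F ≠ 0 ∧
  ∀ x : Sig 2 (fun _ => 1) → K,
    (∃ c : K, (fun j : Fin 2 => x ⟨0, j⟩) = c • P.rep) → MvPolynomial.eval x F = 0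

/-- `F` is "the" form of degree `(0,1)` vanishing at all points of `ℙ^1 × ℙ^1` whose
second coordinate is `P`. -/
def IsForm2Of (P : Proj1 K) (F : R2 K) : Prop :=
  IsWeightedHomogeneous (wt 2 (fun _ => 1)) F (Pi.single 1 1) ∧ F ≠ 0 ∧
  ∀ x : Sig 2 (fun _ => 1) → K,
    (∃ c : K, (fun j : Fin 2 => x ⟨1, j⟩) = c • P.rep) → MvPolynomial.eval x F = 0

end PaperMP

namespace PaperMP

/-- A nonzero form of degree `e_i` vanishing at all points whose `i`-th coordinate is `P`. -/
def IsFormOf (K : Type) [Field K] (i : Fin 2) (P : Proj1 K) (F : R2 K) : Prop :=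
  IsWeightedHomogeneous (wt 2 (fun _ => 1)) F (Pi.single i 1) ∧ F ≠ 0 ∧
  ∀ x : Sig 2 (fun _ => 1) → K,
    (∃ c : K, (fun j : Fin 2 => x ⟨i, j⟩) = c • P.rep) → MvPolynomial.eval x F = 0

theorem weight_wt_apply (d : Sig 2 (fun _ => 1) →₀ ℕ) (i : Fin 2) :
    Finsupp.weight (wt 2 (fun _ => 1)) d i = d ⟨i, 0⟩ + d ⟨i, 1⟩ := by
  rw [Finsupp.weight_apply, Finsupp.sum_fintype _ _ (by simp)]
  fin_cases i <;> simp [Fintype.sum_sigma, Fin.sum_univ_two, wt]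

theorem exists_eq_linear {K : Type} [Field K] {i : Fin 2} {F : R2 K}
    (hF : IsWeightedHomogeneous (wt 2 (fun _ => 1)) F (Pi.single i 1)) :
    ∃ c₀ c₁ : K, F = C c₀ * X ⟨i, 0⟩ + C c₁ * X ⟨i, 1⟩ := by
  classical
  refine ⟨coeff (Finsupp.single ⟨i, 0⟩ 1) F, coeff (Finsupp.single ⟨i, 1⟩ 1) F, ?_⟩
  ext d
  simp only [coeff_add, coeff_C_mul, coeff_X, mul_ite, mul_one, mul_zero]
  split_ifs with h0 h1 h1
  · have := h0.trans h1.symm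
    rw [Finsupp.single_left_inj one_ne_zero] at this
    simp at this
  · simp [h0]
  · simp [h1]
  · by_contra hd
    rw [add_zero] at hd
    have hw := hF hd
    have key : ∀ l, d ⟨l, 0⟩ + d ⟨l, 1⟩ = (Pi.single i 1 : Fin 2 → ℕ) l := fun l => by
      rw [← weight_wt_apply, hw]
    have hi := key i
    rw [Pi.single_eq_same] at hi
    have hne : ∀ l, l ≠ i → d ⟨l, 0⟩ = 0 ∧ d ⟨l, 1⟩ = 0 := fun l hl => by
      have := key l
      rw [Pi.single_eq_of_ne hl] at this
      omega
    have hcase : (d ⟨i, 0⟩ = 1 ∧ d ⟨i, 1⟩ = 0) ∨ (d ⟨i, 0⟩ = 0 ∧ d ⟨i, 1⟩ = 1) := by omega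
    rcases hcase with ⟨e0, e1⟩ | ⟨e0, e1⟩
    · apply h0
      ext ⟨l, j⟩
      by_cases hl : l = i
      · subst hl
        fin_cases j <;> simp [e0, e1]
      · have := hne l hl
        fin_cases j <;> simp [this, Ne.symm hl]
    · apply h1
      ext ⟨l, j⟩
      by_cases hl : l = i
      · subst hl
        fin_cases j <;> simp [e0, e1]
      · have := hne l hl
        fin_cases j <;> simp [this, Ne.symm hl]

theorem exists_dual {K : Type} [Field K] {a : Fin 2 → K} (ha : a ≠ 0) :
    ∃ w₀ w₁ : K, w₀ * a 0 + w₁ * a 1 = 1 := by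
  by_cases h : a 0 = 0
  · have h1 : a 1 ≠ 0 := fun h1 => ha (by ext j; fin_cases j <;> simp [h, h1])
    exact ⟨0, (a 1)⁻¹, by simp [h1]⟩
  · exact ⟨(a 0)⁻¹, 0, by simp [h]⟩

/-- A form of degree `e_i` through `P` is the determinantal form up to a nonzero scalar. -/
theorem IsFormOf.exists_eq {K : Type} [Field K] {i : Fin 2} {P : Proj1 K} {F : R2 K}
    (hF : IsFormOf K i P F) :
    ∃ s : K, s ≠ 0 ∧ F = C s * (C (P.rep 1) * X ⟨i, 0⟩ - C (P.rep 0) * X ⟨i, 1⟩) := by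
  obtain ⟨hw, h0, hv⟩ := hF
  obtain ⟨c₀, c₁, rfl⟩ := exists_eq_linear hw
  obtain ⟨w₀, w₁, hww⟩ := exists_dual P.rep_nonzero
  have hc := hv (fun p => P.rep p.2) ⟨1, by simp⟩
  simp only [map_add, map_mul, eval_C, eval_X] at hc
  have e0 : (c₀ * w₁ - c₁ * w₀) * P.rep 1 = c₀ := by linear_combination c₀ * hww - w₀ * hc
  have e1 : (c₀ * w₁ - c₁ * w₀) * P.rep 0 = -c₁ := by linear_combination -c₁ * hww + w₁ * hc
  have heq : (C c₀ * X ⟨i, 0⟩ + C c₁ * X ⟨i, 1⟩ : R2 K) = C (c₀ * w₁ - c₁ * w₀) *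
      (C (P.rep 1) * X ⟨i, 0⟩ - C (P.rep 0) * X ⟨i, 1⟩) := by
    rw [mul_sub, ← mul_assoc, ← mul_assoc, ← C_mul, ← C_mul, e0, e1, C_neg]
    ring
  refine ⟨_, fun hs => h0 ?_, heq⟩
  rw [heq, hs]
  simp

theorem IsFormOf.eq_of_eval_eq_zero {K : Type} [Field K] {i : Fin 2} {P Q : Proj1 K} {F : R2 K}
    (hF : IsFormOf K i P F) {x : Sig 2 (fun _ => 1) → K} (hx : ∀ j, x ⟨i, j⟩ = Q.rep j)
    (h : eval x F = 0) : Q = P := by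
  obtain ⟨s, hs, rfl⟩ := hF.exists_eq
  simp only [map_mul, map_sub, eval_C, eval_X, hx, mul_eq_zero, hs, false_or] at h
  obtain ⟨w₀, w₁, hww⟩ := exists_dual P.rep_nonzero
  rw [← P.mk_rep, ← Q.mk_rep, Projectivization.mk_eq_mk_iff']
  refine ⟨w₀ * Q.rep 0 + w₁ * Q.rep 1, ?_⟩
  ext j
  fin_cases j
  · simp only [Pi.smul_apply, smul_eq_mul, Fin.zero_eta]
    linear_combination Q.rep 0 * hww - w₁ * h
  · simp only [Pi.smul_apply, smul_eq_mul, Fin.mk_one]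
    linear_combination Q.rep 1 * hww + w₀ * h

/-- The endomorphism of the coordinate ring induced by the projection of the `i`-th factor
`K²` onto the line spanned by `a`, along the kernel of `(w₀, w₁)`. -/
def lineProj {K : Type} [Field K] (i : Fin 2) (a : Fin 2 → K) (w₀ w₁ : K) : R2 K →ₐ[K] R2 K :=
  aeval fun p : Sig 2 (fun _ => 1) =>
    if p.1 = i then C (a p.2) * (C w₀ * X ⟨i, 0⟩ + C w₁ * X ⟨i, 1⟩) else X p

theorem eval_lineProj {K : Type} [Field K] (i : Fin 2) (a : Fin 2 → K) (w₀ w₁ : K)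
    (x : Sig 2 (fun _ => 1) → K) (G : R2 K) :
    eval x (lineProj i a w₀ w₁ G) =
      eval (fun p => if p.1 = i then a p.2 * (w₀ * x ⟨i, 0⟩ + w₁ * x ⟨i, 1⟩) else x p) G := by
  induction G using MvPolynomial.induction_on with
  | C c => simp [lineProj, algebraMap_eq]
  | add p q hp hq => simp [hp, hq]
  | mul_X p q hp =>
    rw [map_mul, map_mul, map_mul, hp]
    congr 1
    rw [lineProj, aeval_X, eval_X]
    split_ifs <;> simp

theorem lineProj_eq_zero_iff {K : Type} [Field K] [Infinite K] {i : Fin 2} {a : Fin 2 → K}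
    {w₀ w₁ : K} (hw : w₀ * a 0 + w₁ * a 1 = 1) (G : R2 K) :
    lineProj i a w₀ w₁ G = 0 ↔ ∀ x : Sig 2 (fun _ => 1) → K,
      (∃ c : K, (fun j : Fin 2 => x ⟨i, j⟩) = c • a) → eval x G = 0 := by
  constructor
  · rintro h x ⟨c, hc⟩
    have hx : ∀ j : Fin 2, x ⟨i, j⟩ = c * a j := fun j => congrFun hc j
    have := eval_lineProj i a w₀ w₁ x G
    rw [h, map_zero] at this
    rw [this]
    congr 2
    ext ⟨l, j⟩
    split_ifs with hl
    · dsimp only at hl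
      subst hl
      rw [hx 0, hx 1, hx j]
      linear_combination -(c * a j) * hw
    · rfl
  · intro h
    refine MvPolynomial.funext fun x => ?_
    rw [eval_lineProj, map_zero]
    refine h _ ⟨w₀ * x ⟨i, 0⟩ + w₁ * x ⟨i, 1⟩, ?_⟩
    ext j
    simp [mul_comm]

theorem IsFormOf.dvd_sub_lineProj {K : Type} [Field K] {i : Fin 2} {P : Proj1 K} {F : R2 K}
    (hF : IsFormOf K i P F) {w₀ w₁ : K} (hw : w₀ * P.rep 0 + w₁ * P.rep 1 = 1) (G : R2 K) :
    F ∣ G - lineProj i P.rep w₀ w₁ G := by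
  obtain ⟨s, hs, rfl⟩ := hF.exists_eq
  rw [(IsUnit.map C (isUnit_iff_ne_zero.mpr hs)).mul_left_dvd]
  have hwC : (C w₀ * C (P.rep 0) + C w₁ * C (P.rep 1) : R2 K) = 1 := by
    rw [← C_mul, ← C_mul, ← C_add, hw, C_1]
  induction G using MvPolynomial.induction_on with
  | C c => simp [lineProj, algebraMap_eq]
  | add p q hp hq =>
    rw [map_add, add_sub_add_comm]
    exact dvd_add hp hq
  | mul_X p q hp =>
    have hX : (C (P.rep 1) * X ⟨i, 0⟩ - C (P.rep 0) * X ⟨i, 1⟩ : R2 K) ∣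
        X q - lineProj i P.rep w₀ w₁ (X q) := by
      obtain ⟨l, j⟩ := q
      rw [lineProj, aeval_X]
      split_ifs with hl
      · dsimp only at hl
        subst hl
        fin_cases j
        · refine ⟨C w₁, ?_⟩
          dsimp only [Fin.zero_eta]
          linear_combination -(X ⟨l, 0⟩ : R2 K) * hwC
        · refine ⟨-C w₀, ?_⟩
          dsimp only [Fin.mk_one]
          linear_combination -(X ⟨l, 1⟩ : R2 K) * hwC
      · simp
    rw [map_mul]
    have := dvd_add (hp.mul_right (X q)) (hX.mul_left (lineProj i P.rep w₀ w₁ p))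
    convert this using 1
    ring

theorem IsFormOf.dvd_iff {K : Type} [Field K] [Infinite K] {i : Fin 2} {P : Proj1 K} {F : R2 K}
    (hF : IsFormOf K i P F) {w₀ w₁ : K} (hw : w₀ * P.rep 0 + w₁ * P.rep 1 = 1) (G : R2 K) :
    F ∣ G ↔ lineProj i P.rep w₀ w₁ G = 0 := by
  constructor
  · rintro ⟨H, rfl⟩
    rw [map_mul, (lineProj_eq_zero_iff hw F).mpr hF.2.2, zero_mul]
  · intro h
    simpa [h] using hF.dvd_sub_lineProj hw G

theorem IsFormOf.prime {K : Type} [Field K] [Infinite K] {i : Fin 2} {P : Proj1 K} {F : R2 K}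
    (hF : IsFormOf K i P F) : Prime F := by
  obtain ⟨w₀, w₁, hw⟩ := exists_dual P.rep_nonzero
  refine ⟨hF.2.1, fun hu => ?_, fun a b => ?_⟩
  · rw [isUnit_iff_dvd_one, hF.dvd_iff hw, map_one] at hu
    exact one_ne_zero hu
  · simp only [hF.dvd_iff hw, map_mul, mul_eq_zero, imp_self]

theorem prod_dvd_of_forall_eval_eq_zero {K : Type} [Field K] [Infinite K] {i : Fin 2} {r : ℕ}
    {Q : Fin r → Proj1 K} (hQ : Function.Injective Q) {L : Fin r → R2 K}
    (hL : ∀ m, IsFormOf K i (Q m) (L m)) {G : R2 K}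
    (hG : ∀ m, ∀ x : Sig 2 (fun _ => 1) → K,
      (∃ c : K, (fun j : Fin 2 => x ⟨i, j⟩) = c • (Q m).rep) → eval x G = 0) :
    ∏ m, L m ∣ G := by
  refine Finset.prod_dvd_of_isRelPrime (fun m _ m' _ hne => ?_) fun m _ => ?_
  · refine ((hL m).prime.irreducible.isRelPrime_iff_not_dvd).mpr ?_
    rintro ⟨H, hH⟩
    have hx : eval (fun p : Sig 2 (fun _ => 1) => (Q m).rep p.2) (L m') = 0 := by
      rw [hH, map_mul, (hL m).2.2 _ ⟨1, by simp⟩, zero_mul]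
    exact hne (hQ ((hL m').eq_of_eval_eq_zero (fun _ => rfl) hx))
  · obtain ⟨w₀, w₁, hw⟩ := exists_dual (Q m).rep_nonzero
    exact ((hL m).dvd_iff hw G).mpr ((lineProj_eq_zero_iff hw G).mpr (hG m))

theorem mem_idealOfPoint {K : Type} [Field K] {k : ℕ} {n : Fin k → ℕ} {P : MPPoint K k n}
    {G : MPRing K k n} :
    G ∈ idealOfPoint K k n P ↔ ∀ x ∈ cone K k n P, eval x G = 0 := by
  simp [idealOfPoint, vanishingIdeal, RingHom.mem_ker]

theorem mem_idealOfSet {K : Type} [Field K] {k : ℕ} {n : Fin k → ℕ} {X : Set (MPPoint K k n)}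
    {G : MPRing K k n} :
    G ∈ idealOfSet K k n X ↔ ∀ P ∈ X, G ∈ idealOfPoint K k n P := by
  simp [idealOfSet]

theorem idealOfPoint_eq_ker {K : Type} [Field K] [Infinite K] {k : ℕ} {n : Fin k → ℕ}
    (P : MPPoint K k n) :
    idealOfPoint K k n P = RingHom.ker (aeval (R := K)
      fun p : Sig k n => (C ((P p.1).rep p.2) * X p.1 : MvPolynomial (Fin k) K)) := by
  have key : ∀ (t : Fin k → K) (G : MPRing K k n),
      eval t (aeval (fun p : Sig k n => (C ((P p.1).rep p.2) * X p.1 : MvPolynomial (Fin k) K)) G)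
        = eval (fun p => (P p.1).rep p.2 * t p.1) G := by
    intro t G
    induction G using MvPolynomial.induction_on with
    | C c => simp [algebraMap_eq]
    | add p q hp hq => simp only [map_add, hp, hq]
    | mul_X p q hp => rw [map_mul, map_mul, map_mul, hp]; simp
  ext G
  rw [mem_idealOfPoint, RingHom.mem_ker]
  constructor
  · intro h
    refine MvPolynomial.funext fun t => ?_
    rw [key, map_zero]
    refine h _ fun i => ⟨t i, ?_⟩
    ext j
    simp [mul_comm]
  · intro h x hx
    choose c hc using hx
    have := key c G
    rw [h, map_zero] at this
    rw [this]
    congr 2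
    ext ⟨i, j⟩
    simpa [mul_comm] using congrFun (hc i) j

theorem idealOfPoint_isPrime {K : Type} [Field K] [Infinite K] {k : ℕ} {n : Fin k → ℕ}
    (P : MPPoint K k n) : (idealOfPoint K k n P).IsPrime := by
  rw [idealOfPoint_eq_ker]
  exact RingHom.ker_isPrime _

/-- if `P_1 ∈ π_1(X)`, `X_{P_1}` is its fiber, `Z = X \ X_{P_1}`, and
`π_2(X_{P_1}) = π_2(X) = {Q_1,…,Q_r}`, then with `F = L_{Q_1}⋯L_{Q_r}` one has
`I_X = L_{P_1}·I_Z + (F)`. -/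
theorem statement_15 (K : Type) [Field K] [IsAlgClosed K] [CharZero K]
    (X : Set (Pt2 K)) (hX : X.Finite)
    (P1 : Proj1 K) (hP1 : P1 ∈ (fun Z : Pt2 K => Z 0) '' X)
    (LP1 : R2 K) (hLP1 : IsForm1Of K P1 LP1)
    (r : ℕ) (Q : Fin r → Proj1 K) (hQinj : Function.Injective Q)
    (hQrange : Set.range Q = (fun Z : Pt2 K => Z 1) '' X)
    (hproj : (fun Z : Pt2 K => Z 1) '' {Z | Z ∈ X ∧ Z 0 = P1} =
      (fun Z : Pt2 K => Z 1) '' X)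
    (LQ : Fin r → R2 K) (hLQ : ∀ i, IsForm2Of K (Q i) (LQ i))
    (F : R2 K) (hF : F = ∏ i, LQ i) :
    idealOfSet K 2 (fun _ => 1) X =
      Ideal.span {LP1} * idealOfSet K 2 (fun _ => 1) {Z | Z ∈ X ∧ Z 0 ≠ P1} ⊔
        Ideal.span {F} := by
  have hLP : IsFormOf K 0 P1 LP1 := hLP1
  have hLQ' : ∀ m, IsFormOf K 1 (Q m) (LQ m) := hLQ
  have hFX : F ∈ idealOfSet K 2 (fun _ => 1) X := by
    refine mem_idealOfSet.mpr fun A hA => mem_idealOfPoint.mpr fun x hx => ?_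
    obtain ⟨m, hm⟩ : A 1 ∈ Set.range Q := hQrange ▸ ⟨A, hA, rfl⟩
    rw [hF, map_prod]
    exact Finset.prod_eq_zero (Finset.mem_univ m) ((hLQ' m).2.2 x (hm ▸ hx 1))
  apply le_antisymm
  · intro G hG
    obtain ⟨w₀, w₁, hw⟩ := exists_dual P1.rep_nonzero
    have hdvd : F ∣ lineProj 0 P1.rep w₀ w₁ G := by
      rw [hF]
      refine prod_dvd_of_forall_eval_eq_zero hQinj hLQ' fun m x hx => ?_
      obtain ⟨A, ⟨hAX, hA0⟩, hA1⟩ : Q m ∈ (fun Z : Pt2 K => Z 1) '' {Z | Z ∈ X ∧ Z 0 = P1} :=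
        hproj ▸ hQrange ▸ Set.mem_range_self m
      dsimp only at hA1
      rw [eval_lineProj]
      refine mem_idealOfPoint.mp (mem_idealOfSet.mp hG A hAX) _ fun i => ?_
      fin_cases i
      · refine ⟨w₀ * x ⟨0, 0⟩ + w₁ * x ⟨0, 1⟩, ?_⟩
        ext j
        simp [hA0, mul_comm]
      · obtain ⟨c, hc⟩ := hx
        refine ⟨c, ?_⟩
        simpa [hA1] using hc
    obtain ⟨H, hH⟩ := hdvd
    obtain ⟨g, hg⟩ := hLP.dvd_sub_lineProj hw G
    have hGeq : G = LP1 * g + F * H := by rw [← hg, ← hH]; ring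
    rw [hGeq]
    refine Submodule.add_mem_sup (Ideal.mul_mem_mul (Ideal.mem_span_singleton_self _) ?_)
      (Ideal.mul_mem_right _ _ (Ideal.mem_span_singleton_self _))
    refine mem_idealOfSet.mpr fun A hA => ?_
    have hmem : LP1 * g ∈ idealOfPoint K 2 (fun _ => 1) A := by
      rw [eq_sub_of_add_eq hGeq.symm]
      exact mem_idealOfSet.mp (sub_mem hG (Ideal.mul_mem_right _ _ hFX)) A hA.1
    refine ((idealOfPoint_isPrime A).mem_or_mem hmem).resolve_left fun hL => hA.2 ?_
    exact hLP.eq_of_eval_eq_zero (x := fun p => (A p.1).rep p.2) (fun _ => rfl)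
      (mem_idealOfPoint.mp hL _ fun i => ⟨1, by simp⟩)
  · refine sup_le ?_ ((Ideal.span_singleton_le_iff_mem _).mpr hFX)
    refine Ideal.span_singleton_mul_le_iff.mpr fun g hg => ?_
    refine mem_idealOfSet.mpr fun A hA => ?_
    by_cases h0 : A 0 = P1
    · refine Ideal.mul_mem_right _ _ (mem_idealOfPoint.mpr fun x hx => ?_)
      exact hLP.2.2 x (h0 ▸ hx 0)
    · exact Ideal.mul_mem_left _ _ (mem_idealOfSet.mp hg A ⟨hA, h0⟩)

end PaperMP
end
end

section
/- Let X be a finite set of distinct points in ℙ^1 × ℙ^1 with α_X = (α_1,…,α_t) and π_1(X) = {P_1,…,P_t}, labeled so that |π_1^{-1}(P_i) ∩ X| = α_i. For 0 ≤ i ≤ t−1 set X_i := X \ (π_1^{-1}(P_1) ∪ ⋯ ∪ π_1^{-1}(P_i)), with X_0 := X. If X is ACM, then for each 0 ≤ i ≤ t−1 the set X_i is ACM with α_{X_i} = (α_{i+1}, α_{i+2},…,α_t). -/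
open MvPolynomial

noncomputable section

namespace PaperMP

section

variable {K : Type} [Field K]

theorem mem_sup_span_singleton {A : Type*} [CommRing A] {I : Ideal A} {x a : A} :
    a ∈ I ⊔ Ideal.span {x} ↔ ∃ h, a - x * h ∈ I := by
  rw [Submodule.mem_sup]
  constructor
  · rintro ⟨u, hu, v, hv, rfl⟩
    obtain ⟨h, rfl⟩ := Ideal.mem_span_singleton'.1 hv
    exact ⟨h, by simpa [mul_comm] using hu⟩
  · rintro ⟨h, hh⟩
    exact ⟨_, hh, x * h, Ideal.mem_span_singleton'.2 ⟨h, mul_comm _ _⟩, by ring⟩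

/-- Parametrization of the cone over the point with coordinates `(1 - l * e i, e i)` in the
`i`-th factor. -/
def coordHom (l : K) (e : Fin 2 → K) : R2 K →ₐ[K] MvPolynomial (Fin 2) K :=
  aeval fun p => C (if p.2 = 0 then 1 - l * e p.1 else e p.1) * X p.1

/-- The linear form `x_{i,0} + l x_{i,1}`. -/
def unitForm (l : K) (i : Fin 2) : R2 K := X ⟨i, 0⟩ + C l * X ⟨i, 1⟩

/-- The linear form vanishing at the point with coordinate `c` of the `i`-th factor. -/
def pointForm (l : K) (i : Fin 2) (c : K) : R2 K := X ⟨i, 1⟩ - C c * unitForm l i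

@[simp]
theorem coordHom_unitForm (l : K) (e : Fin 2 → K) (i : Fin 2) :
    coordHom l e (unitForm l i) = X i := by
  simp [coordHom, unitForm, algHom_C]
  ring

@[simp]
theorem coordHom_pointForm (l : K) (e : Fin 2 → K) (i : Fin 2) (c : K) :
    coordHom l e (pointForm l i c) = C (e i - c) * X i := by
  rw [pointForm, map_sub, map_mul, coordHom_unitForm]
  simp [coordHom, algHom_C]
  ring

/-- The ideal of the points with coordinates in `E`. -/
def pointsIdeal (l : K) (E : Set (Fin 2 → K)) : Ideal (R2 K) :=
  ⨅ e ∈ E, RingHom.ker (coordHom l e)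

theorem mem_pointsIdeal {l : K} {E : Set (Fin 2 → K)} {u : R2 K} :
    u ∈ pointsIdeal l E ↔ ∀ e ∈ E, coordHom l e u = 0 := by
  simp [pointsIdeal, Submodule.mem_iInf, RingHom.mem_ker]

/-- The two coordinate forms, raised to any powers, form a regular sequence modulo the ideal
of `E`. -/
def UnitFormsRegular (l : K) (E : Set (Fin 2 → K)) : Prop :=
  ∀ (M N : ℕ) (a : R2 K),
    unitForm l 1 ^ M * a ∈ pointsIdeal l E ⊔ Ideal.span {unitForm l 0 ^ N} →
      a ∈ pointsIdeal l E ⊔ Ideal.span {unitForm l 0 ^ N}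

theorem unitForm_pow_mul_mem {l : K} {E : Set (Fin 2 → K)} {i : Fin 2} {N : ℕ} {u : R2 K}
    (h : unitForm l i ^ N * u ∈ pointsIdeal l E) : u ∈ pointsIdeal l E := by
  rw [mem_pointsIdeal] at h ⊢
  intro e he
  have := h e he
  rw [map_mul, map_pow, coordHom_unitForm] at this
  exact (mul_eq_zero.1 this).resolve_left (pow_ne_zero _ (X_ne_zero i))

/-! ### Grading by the degree in the second set of variables -/

/-- The homomorphism multiplying the second set of variables by a parameter. -/
def scaleHom : R2 K →ₐ[K] Polynomial (R2 K) :=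
  aeval fun p => if p.1 = 0 then Polynomial.C (X p) else Polynomial.C (X p) * Polynomial.X

/-- The component of degree `j` in the second set of variables. -/
def comp (j : ℕ) (h : R2 K) : R2 K := (scaleHom h).coeff j

theorem scaleHom_X_zero (j : Fin 2) :
    scaleHom (K := K) (X ⟨0, j⟩) = Polynomial.C (X ⟨0, j⟩) := by
  simp [scaleHom]

theorem scaleHom_X_one (j : Fin 2) :
    scaleHom (K := K) (X ⟨1, j⟩) = Polynomial.C (X ⟨1, j⟩) * Polynomial.X := by
  simp [scaleHom]

theorem scaleHom_unitForm_zero (l : K) :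
    scaleHom (unitForm l 0) = Polynomial.C (unitForm l 0) := by
  simp [unitForm, scaleHom_X_zero]

theorem scaleHom_unitForm_one (l : K) :
    scaleHom (unitForm l 1) = Polynomial.C (unitForm l 1) * Polynomial.X := by
  simp [unitForm, scaleHom_X_one]
  ring

theorem scaleHom_pointForm_zero (l c : K) :
    scaleHom (pointForm l 0 c) = Polynomial.C (pointForm l 0 c) := by
  simp [pointForm, scaleHom_X_zero, scaleHom_unitForm_zero]

theorem scaleHom_pointForm_one (l c : K) :
    scaleHom (pointForm l 1 c) = Polynomial.C (pointForm l 1 c) * Polynomial.X := by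
  simp [pointForm, scaleHom_X_one, scaleHom_unitForm_one]
  ring

theorem scaleHom_comp (h : R2 K) : ∀ j,
    scaleHom (comp j h) = Polynomial.C (comp j h) * Polynomial.X ^ j := by
  induction h using MvPolynomial.induction_on with
  | C a =>
    rintro (_ | j)
    · simp [comp]
    · simp [comp]
  | add p q hp hq =>
    intro j
    have : comp j (p + q) = comp j p + comp j q := by simp [comp]
    simp [this, hp j, hq j, add_mul]
  | mul_X p n hp =>
    obtain ⟨i, m⟩ := n
    fin_cases i
    · intro j
      have : comp j (p * X ⟨0, m⟩) = comp j p * X ⟨0, m⟩ := by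
        simp [comp, scaleHom_X_zero]
      simp only [Fin.zero_eta, this, map_mul, hp j]
      rw [scaleHom_X_zero]
      ring
    · rintro (_ | j)
      · have : comp 0 (p * X ⟨1, m⟩) = 0 := by
          simp [comp, scaleHom_X_one]
        simp only [Fin.mk_one, this]
        simp
      · have : comp (j + 1) (p * X ⟨1, m⟩) = comp j p * X ⟨1, m⟩ := by
          simp [comp, scaleHom_X_one, ← mul_assoc]
        simp only [Fin.mk_one, this, map_mul, hp j]
        rw [scaleHom_X_one]
        ring

theorem sum_comp (h : R2 K) :
    h = ∑ j ∈ Finset.range ((scaleHom h).natDegree + 1), comp j h := by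
  have key : (((Polynomial.aeval (1 : R2 K)).restrictScalars K).comp scaleHom :
      R2 K →ₐ[K] R2 K) = AlgHom.id K _ := by
    ext p
    by_cases hp : p.1 = 0 <;> simp [scaleHom, hp]
  have := DFunLike.congr_fun key h
  simp only [AlgHom.comp_apply, AlgHom.restrictScalars_apply, AlgHom.id_apply] at this
  conv_lhs => rw [← this, Polynomial.aeval_eq_sum_range]
  simp [comp]

theorem comp_comp_self (j : ℕ) {h : R2 K}
    (hh : scaleHom h = Polynomial.C h * Polynomial.X ^ j) : comp j h = h := by
  simp [comp, hh]

theorem comp_sub (j : ℕ) (a b : R2 K) : comp j (a - b) = comp j a - comp j b := by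
  simp [comp]

theorem comp_add (j : ℕ) (a b : R2 K) : comp j (a + b) = comp j a + comp j b := by
  simp [comp]

theorem comp_zero_mul (j : ℕ) {a : R2 K} (ha : scaleHom a = Polynomial.C a) (b : R2 K) :
    comp j (a * b) = a * comp j b := by
  simp [comp, ha]

theorem comp_succ_mul (j : ℕ) {a : R2 K} (ha : scaleHom a = Polynomial.C a * Polynomial.X)
    (b : R2 K) : comp (j + 1) (a * b) = a * comp j b := by
  simp [comp, ha, mul_assoc]

theorem comp_degree_zero_mul {a : R2 K} (ha : scaleHom a = Polynomial.C a * Polynomial.X)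
    (b : R2 K) : comp 0 (a * b) = 0 := by
  simp [comp, ha]

theorem comp_pow_mul (j M : ℕ) {a : R2 K} (ha : scaleHom a = Polynomial.C a * Polynomial.X)
    (b : R2 K) : comp (j + M) (a ^ M * b) = a ^ M * comp j b := by
  induction M with
  | zero => simp
  | succ M ih =>
    rw [pow_succ', mul_assoc, ← add_assoc, comp_succ_mul _ ha, ih, mul_assoc]

theorem coordHom_comp_eq_zero {l : K} {e : Fin 2 → K} {u : R2 K} (hu : coordHom l e u = 0)
    (j : ℕ) : coordHom l e (comp j u) = 0 := by
  have key : (Polynomial.mapAlgHom (coordHom l e)).comp scaleHom =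
      (aeval (fun i : Fin 2 => if i = 0 then Polynomial.C (X i) else
        Polynomial.C (X i) * Polynomial.X) :
        MvPolynomial (Fin 2) K →ₐ[K] Polynomial (MvPolynomial (Fin 2) K)).comp
        (coordHom l e) := by
    ext1 p
    have hC : ∀ a : K, algebraMap K (Polynomial (MvPolynomial (Fin 2) K)) a =
      Polynomial.C (C a) := fun a => rfl
    by_cases hp : p.1 = 0 <;> simp [scaleHom, hp, coordHom, algHom_C, hC, mul_assoc]
  have := congrArg (fun q => q.coeff j) (DFunLike.congr_fun key u)
  simpa [hu, comp] using this

theorem comp_mem {l : K} {E : Set (Fin 2 → K)} {u : R2 K} (hu : u ∈ pointsIdeal l E) (j : ℕ) :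
    comp j u ∈ pointsIdeal l E := by
  rw [mem_pointsIdeal] at hu ⊢
  exact fun e he => coordHom_comp_eq_zero (hu e he) j


/-! ### Independence of the choice of a system of parameters -/

theorem mem_of_regular_pair {A : Type*} [CommRing A] {I : Ideal A} {f g x : A}
    (hf : ∀ G, f * G ∈ I → G ∈ I)
    (hg : ∀ G, g * G ∈ I ⊔ Ideal.span {f} → G ∈ I ⊔ Ideal.span {f})
    (hx : ∀ G, x * G ∈ I → G ∈ I) {a : A} (h1 : f * a ∈ I ⊔ Ideal.span {x})
    (h2 : g * a ∈ I ⊔ Ideal.span {x}) : a ∈ I ⊔ Ideal.span {x} := by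
  obtain ⟨a1, h1⟩ := mem_sup_span_singleton.1 h1
  obtain ⟨a2, h2⟩ := mem_sup_span_singleton.1 h2
  have h3 : g * a1 - f * a2 ∈ I := by
    refine hx _ ?_
    have := I.sub_mem (I.mul_mem_left f h2) (I.mul_mem_left g h1)
    convert this using 1
    ring
  obtain ⟨h, hh⟩ := mem_sup_span_singleton.1 (hg a1 (mem_sup_span_singleton.2 ⟨a2, h3⟩))
  refine mem_sup_span_singleton.2 ⟨h, hf _ ?_⟩
  convert I.add_mem h1 (I.mul_mem_left x hh) using 1
  ring

theorem mem_of_regular_pair_pow {A : Type*} [CommRing A] {I : Ideal A} {f g x : A}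
    (hf : ∀ G, f * G ∈ I → G ∈ I)
    (hg : ∀ G, g * G ∈ I ⊔ Ideal.span {f} → G ∈ I ⊔ Ideal.span {f})
    (hx : ∀ G, x * G ∈ I → G ∈ I) (n m : ℕ) {a : A} (h1 : f ^ n * a ∈ I ⊔ Ideal.span {x})
    (h2 : g ^ m * a ∈ I ⊔ Ideal.span {x}) : a ∈ I ⊔ Ideal.span {x} := by
  have aux : ∀ (m : ℕ) (a : A), f * a ∈ I ⊔ Ideal.span {x} → g ^ m * a ∈ I ⊔ Ideal.span {x} →
      a ∈ I ⊔ Ideal.span {x} := by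
    intro m
    induction m with
    | zero => intro a _ h; simpa using h
    | succ m ih =>
      intro a h1 h2
      refine mem_of_regular_pair hf hg hx h1 (ih _ ?_ ?_)
      · rw [mul_left_comm]
        exact Ideal.mul_mem_left _ _ h1
      · rwa [← mul_assoc, ← pow_succ]
  induction n generalizing a with
  | zero => simpa using h1
  | succ n ih =>
    refine aux m a (ih ?_ ?_) h2
    · rwa [← mul_assoc, ← pow_succ]
    · rw [mul_left_comm]
      exact Ideal.mul_mem_left _ _ h2

theorem prod_pointForm_mem (l : K) (E : Finset (Fin 2 → K)) (i : Fin 2) :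
    ∏ e ∈ E, pointForm l i (e i) ∈ pointsIdeal l (E : Set (Fin 2 → K)) := by
  rw [mem_pointsIdeal]
  intro e he
  rw [map_prod]
  exact Finset.prod_eq_zero he (by simp)

theorem exists_pow_mem [IsAlgClosed K] (l : K) (E : Finset (Fin 2 → K)) (M N : ℕ) {f : R2 K}
    (hf : f ∈ maxIdeal K 2 (fun _ => 1)) :
    ∃ n, f ^ n ∈ (pointsIdeal l (E : Set (Fin 2 → K)) ⊔ Ideal.span {unitForm l 0 ^ N}) ⊔
      Ideal.span {unitForm l 1 ^ M} := by
  set J := (pointsIdeal l (E : Set (Fin 2 → K)) ⊔ Ideal.span {unitForm l 0 ^ N}) ⊔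
      Ideal.span {unitForm l 1 ^ M} with hJ
  change f ∈ J.radical
  rw [← vanishingIdeal_zeroLocus_eq_radical (K := K), mem_vanishingIdeal_iff]
  intro x hx
  rw [mem_zeroLocus_iff] at hx
  have hu : ∀ i, x ⟨i, 0⟩ + l * x ⟨i, 1⟩ = 0 := by
    intro i
    have hp : ∃ n, unitForm l i ^ n ∈ J := by
      fin_cases i
      · exact ⟨N, Ideal.mem_sup_left (Ideal.mem_sup_right (Ideal.mem_span_singleton_self _))⟩
      · exact ⟨M, Ideal.mem_sup_right (Ideal.mem_span_singleton_self _)⟩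
    obtain ⟨n, hn⟩ := hp
    have := hx _ hn
    rw [map_pow] at this
    simpa [unitForm] using eq_zero_of_pow_eq_zero this
  have h1 : ∀ i, x ⟨i, 1⟩ = 0 := by
    intro i
    have := hx _ (Ideal.mem_sup_left (Ideal.mem_sup_left (prod_pointForm_mem l E i)))
    rw [map_prod, Finset.prod_eq_zero_iff] at this
    obtain ⟨e, _, he⟩ := this
    simpa [pointForm, unitForm, hu i] using he
  have hx0 : x = 0 := by
    funext ⟨i, j⟩
    fin_cases j
    · simpa [h1 i] using hu i
    · exact h1 i
  have hle : maxIdeal K 2 (fun _ => 1) ≤ RingHom.ker (aeval (R := K) x) := by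
    rw [maxIdeal, Ideal.span_le]
    rintro _ ⟨p, rfl⟩
    simp [hx0]
  exact hle hf

theorem unitFormsRegular_of_isRegSeqMod [IsAlgClosed K] {l : K} {E : Finset (Fin 2 → K)}
    {L : List (R2 K)} (hL : L.length = 2)
    (h : IsRegSeqMod K 2 (fun _ => 1) (pointsIdeal l (E : Set (Fin 2 → K))) L) :
    UnitFormsRegular l (E : Set (Fin 2 → K)) := by
  obtain ⟨f, g, rfl⟩ := List.length_eq_two.1 hL
  obtain ⟨hm, hreg⟩ := h
  intro M N a ha
  have hfm : ∀ f' ∈ [f, g], ∃ n, f' ^ n * a ∈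
      pointsIdeal l (E : Set (Fin 2 → K)) ⊔ Ideal.span {unitForm l 0 ^ N} := by
    intro f' hf'
    obtain ⟨n, hn⟩ := exists_pow_mem l E M N (hm (Ideal.mem_sup_right (Ideal.subset_span hf')))
    obtain ⟨k, hk⟩ := mem_sup_span_singleton.1 hn
    refine ⟨n, ?_⟩
    convert Ideal.add_mem _ (Ideal.mul_mem_right a _ hk) (Ideal.mul_mem_left _ k ha) using 1
    ring
  obtain ⟨n, hn⟩ := hfm f (by simp)
  obtain ⟨m, hm⟩ := hfm g (by simp)
  refine mem_of_regular_pair_pow ?_ ?_ ?_ n m hn hm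
  · simpa using hreg 0
  · simpa using hreg 1
  · exact fun G => unitForm_pow_mul_mem

/-! ### Divisibility by the form of a fiber -/

theorem exists_eq_of_coordHom_eq_zero {l : K} {e : Fin 2 → K} {h : R2 K}
    (hh : coordHom l e h = 0) :
    ∃ a k, h = pointForm l 0 (e 0) * a + pointForm l 1 (e 1) * k := by
  set J : Ideal (R2 K) := Ideal.span {pointForm l 0 (e 0), pointForm l 1 (e 1)} with hJ
  have hF : ∀ i, pointForm l i (e i) ∈ J := by
    intro i
    fin_cases i <;> exact Ideal.subset_span (by simp)
  have key : (Ideal.Quotient.mkₐ K J).comp ((aeval (unitForm l)).comp (coordHom l e)) =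
      Ideal.Quotient.mkₐ K J := by
    ext1 ⟨i, j⟩
    simp only [AlgHom.comp_apply, Ideal.Quotient.mkₐ_eq_mk]
    rw [Ideal.Quotient.eq]
    fin_cases j
    · convert J.mul_mem_left (C l) (hF i) using 1
      simp [coordHom, pointForm, unitForm]
      ring
    · convert J.neg_mem (hF i) using 1
      simp [coordHom, pointForm, unitForm]
  have h0 := DFunLike.congr_fun key h
  simp only [AlgHom.comp_apply, hh, map_zero, Ideal.Quotient.mkₐ_eq_mk] at h0
  have := Ideal.Quotient.eq_zero_iff_mem.1 h0.symm
  obtain ⟨a, b, hab⟩ := Ideal.mem_span_pair.1 this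
  exact ⟨a, b, by rw [← hab]; ring⟩

theorem pointForm_dvd_of_vanishing {l c : K} (j : ℕ) : ∀ (S : Finset K) (h : R2 K),
    scaleHom h = Polynomial.C h * Polynomial.X ^ j → j < S.card →
    (∀ d ∈ S, coordHom l ![c, d] h = 0) → pointForm l 0 c ∣ h := by
  classical
  induction j with
  | zero =>
    intro S h hh hS hv
    obtain ⟨d, hd⟩ := Finset.card_pos.1 hS
    obtain ⟨a, k, hak⟩ := exists_eq_of_coordHom_eq_zero (hv d hd)
    have := congrArg (comp 0) hak
    rw [comp_comp_self 0 hh, comp_add, comp_zero_mul _ (scaleHom_pointForm_zero _ _),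
      comp_degree_zero_mul (scaleHom_pointForm_one _ _), add_zero] at this
    exact ⟨_, this⟩
  | succ j ih =>
    intro S h hh hS hv
    obtain ⟨d, hd⟩ := Finset.card_pos.1 (Nat.zero_lt_of_lt hS)
    obtain ⟨a, k, hak⟩ := exists_eq_of_coordHom_eq_zero (hv d hd)
    have hcomp := congrArg (comp (j + 1)) hak
    rw [comp_comp_self _ hh, comp_add, comp_zero_mul _ (scaleHom_pointForm_zero _ _),
      comp_succ_mul _ (scaleHom_pointForm_one _ _)] at hcomp
    simp only [Matrix.cons_val_zero, Matrix.cons_val_one] at hcomp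
    have hk : pointForm l 0 c ∣ comp j k := by
      refine ih (S.erase d) _ (scaleHom_comp _ _) ?_ ?_
      · rw [Finset.card_erase_of_mem hd]
        omega
      · intro d' hd'
        have h0 := hv d' (Finset.mem_of_mem_erase hd')
        rw [hcomp] at h0
        simp only [map_add, map_mul, coordHom_pointForm, Matrix.cons_val_zero,
          Matrix.cons_val_one, sub_self, C_0, zero_mul, zero_add] at h0
        refine (mul_eq_zero.1 h0).resolve_left (mul_ne_zero ?_ (X_ne_zero _))
        rw [Ne, C_eq_zero]
        exact sub_ne_zero.2 (Finset.ne_of_mem_erase hd')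
    rw [hcomp]
    exact dvd_add (dvd_mul_right _ _) (hk.mul_left _)

/-! ### Interpolation -/

theorem exists_coordHom_eq_mul_X_pow {l : K} (e : Fin 2 → K) {j : ℕ} {g : R2 K}
    (hg : scaleHom g = Polynomial.C g * Polynomial.X ^ j) :
    ∃ r : R2 K, coordHom l e g = coordHom l e r * X 1 ^ j := by
  let τ : R2 K →ₐ[K] MvPolynomial (Fin 2) K := aeval fun p =>
    C (if p.2 = 0 then 1 - l * e p.1 else e p.1) * if p.1 = 0 then X p.1 else 1
  have key : (Polynomial.eval₂AlgHom τ (X 1) (fun _ => Commute.all _ _)).comp scaleHom =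
      coordHom l e := by
    ext1 ⟨i, j⟩
    fin_cases i <;> simp [τ, coordHom, scaleHom]
  refine ⟨aeval (unitForm l) (τ g), ?_⟩
  have h1 : coordHom l e (aeval (unitForm l) (τ g)) = τ g := by
    have : (coordHom l e).comp (aeval (unitForm l)) = AlgHom.id K _ := by
      ext1 i
      simp
    exact DFunLike.congr_fun this (τ g)
  rw [h1, ← key, AlgHom.comp_apply, hg]
  simp

theorem exists_separator (l : K) (e : Fin 2 → K) [DecidableEq K] (S : Finset (Fin 2 → K))
    (he : e ∉ S) : ∃ w : R2 K, (∀ e' ∈ S, coordHom l e' w = 0) ∧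
      coordHom l e w = X 0 ^ S.card * X 1 ^ (S.filter fun e' => e' 0 = e 0).card := by
  induction S using Finset.induction_on with
  | empty => exact ⟨1, by simp, by simp⟩
  | insert a S ha ih =>
    obtain ⟨w, hw, hwe⟩ := ih fun h => he (Finset.mem_insert_of_mem h)
    have hane : e ≠ a := fun h => he (h ▸ Finset.mem_insert_self _ _)
    obtain ⟨v, hva, hve⟩ : ∃ v : R2 K, coordHom l a v = 0 ∧
        coordHom l e v = X 0 * if a 0 = e 0 then X 1 else 1 := by
      by_cases h0 : a 0 = e 0
      · have h1 : e 1 - a 1 ≠ 0 := by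
          refine sub_ne_zero.2 fun h => hane ?_
          funext i
          fin_cases i
          · exact h0.symm
          · exact h
        refine ⟨C (e 1 - a 1)⁻¹ * pointForm l 1 (a 1) * unitForm l 0, by simp, ?_⟩
        simp only [map_mul, algHom_C, MvPolynomial.algebraMap_eq, coordHom_pointForm,
          coordHom_unitForm, if_pos h0, ← mul_assoc, ← C_mul, inv_mul_cancel₀ h1]
        simp [mul_comm]
      · have h1 : e 0 - a 0 ≠ 0 := sub_ne_zero.2 fun h => h0 h.symm
        refine ⟨C (e 0 - a 0)⁻¹ * pointForm l 0 (a 0), by simp, ?_⟩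
        simp only [map_mul, algHom_C, MvPolynomial.algebraMap_eq, coordHom_pointForm,
          if_neg h0, ← mul_assoc, ← C_mul, inv_mul_cancel₀ h1]
        simp
    refine ⟨v * w, ?_, ?_⟩
    · intro e' he'
      rw [map_mul]
      rcases Finset.mem_insert.1 he' with rfl | he'
      · rw [hva, zero_mul]
      · rw [hw e' he', mul_zero]
    · rw [map_mul, hve, hwe, Finset.card_insert_of_notMem ha, Finset.filter_insert]
      split_ifs with h0
      · rw [Finset.card_insert_of_notMem (by simp [ha])]
        ring
      · ring

theorem exists_sub_unitForm_mul_mem [DecidableEq K] {l : K} {E : Finset (Fin 2 → K)} {j : ℕ}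
    (hE : ∀ e ∈ E, (E.filter fun e' => e' 0 = e 0).card ≤ j + 1) {g : R2 K}
    (hg : scaleHom g = Polynomial.C g * Polynomial.X ^ (j + 1)) :
    ∃ N g', scaleHom g' = Polynomial.C g' * Polynomial.X ^ j ∧
      unitForm l 0 ^ N * g - unitForm l 1 * g' ∈ pointsIdeal l (E : Set (Fin 2 → K)) := by
  have hsep : ∀ e, ∃ w : R2 K, e ∈ E → (∀ e' ∈ E, e' ≠ e → coordHom l e' w = 0) ∧
      X 1 * coordHom l e w = X 0 ^ (E.card - 1) * coordHom l e g := by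
    intro e
    by_cases he : e ∈ E
    · obtain ⟨w, hw, hwe⟩ := exists_separator l e (E.erase e) (Finset.notMem_erase e E)
      obtain ⟨r, hr⟩ := exists_coordHom_eq_mul_X_pow (l := l) e hg
      have hcard : ((E.erase e).filter fun e' => e' 0 = e 0).card ≤ j := by
        rw [Finset.filter_erase, Finset.card_erase_of_mem (by simp [he])]
        have := hE e he
        omega
      obtain ⟨k, hk⟩ := Nat.exists_eq_add_of_le hcard
      refine ⟨w * unitForm l 1 ^ k * r, fun _ => ⟨fun e' he' hne => ?_, ?_⟩⟩
      · rw [map_mul, map_mul, hw e' (Finset.mem_erase.2 ⟨hne, he'⟩), zero_mul, zero_mul]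
      · rw [map_mul, map_mul, map_pow, coordHom_unitForm, hwe, hr,
          Finset.card_erase_of_mem he]
        conv_rhs => rw [hk]
        ring
    · exact ⟨0, fun h => absurd h he⟩
  choose w hw using hsep
  have hmem : unitForm l 0 ^ (E.card - 1) * g - unitForm l 1 * ∑ e ∈ E, w e ∈
      pointsIdeal l (E : Set (Fin 2 → K)) := by
    rw [mem_pointsIdeal]
    intro e he
    have hsum : coordHom l e (∑ e' ∈ E, w e') = coordHom l e (w e) := by
      rw [map_sum]
      exact Finset.sum_eq_single_of_mem e he fun e' he' hne => (hw e' he').1 e he hne.symm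
    rw [map_sub, map_mul, map_mul, hsum, map_pow, coordHom_unitForm, coordHom_unitForm,
      (hw e he).2, sub_self]
  refine ⟨E.card - 1, comp j (∑ e ∈ E, w e), scaleHom_comp _ _, ?_⟩
  have := comp_mem hmem (j + 1)
  rwa [comp_sub, comp_zero_mul _ (by rw [map_pow, scaleHom_unitForm_zero, map_pow]),
    comp_comp_self _ hg, comp_succ_mul _ (scaleHom_unitForm_one l)] at this

/-! ### Removing a largest fiber -/

theorem pointForm_mul_mem_iff [DecidableEq K] {l c : K} {E : Finset (Fin 2 → K)} {u : R2 K} :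
    pointForm l 0 c * u ∈ pointsIdeal l (E : Set (Fin 2 → K)) ↔
      u ∈ pointsIdeal l (E.filter fun e => e 0 ≠ c : Finset (Fin 2 → K)) := by
  simp only [mem_pointsIdeal, Finset.mem_coe, Finset.mem_filter, map_mul, coordHom_pointForm,
    mul_eq_zero, C_eq_zero, X_ne_zero, or_false, sub_eq_zero]
  exact ⟨fun h e he => (h e he.1).resolve_left he.2, fun h e he =>
    or_iff_not_imp_left.2 fun hc => h e ⟨he, hc⟩⟩

theorem mem_of_lt_card_fiber [DecidableEq K] {l c : K} {E : Finset (Fin 2 → K)}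
    (hD : UnitFormsRegular l (E : Set (Fin 2 → K))) {j M N : ℕ} {g : R2 K}
    (hg : scaleHom g = Polynomial.C g * Polynomial.X ^ j)
    (hj : j < (E.filter fun e => e 0 = c).card)
    (h : unitForm l 1 ^ M * g ∈ pointsIdeal l (E.filter fun e => e 0 ≠ c : Finset (Fin 2 → K)) ⊔
      Ideal.span {unitForm l 0 ^ N}) :
    g ∈ pointsIdeal l (E.filter fun e => e 0 ≠ c : Finset (Fin 2 → K)) ⊔
      Ideal.span {unitForm l 0 ^ N} := by
  have hpow : scaleHom (unitForm l 0 ^ N) = Polynomial.C (unitForm l 0 ^ N) := by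
    rw [map_pow, scaleHom_unitForm_zero, map_pow]
  obtain ⟨k, hk⟩ := mem_sup_span_singleton.1 h
  obtain ⟨k', hk'⟩ := mem_sup_span_singleton.1 (hD M N (pointForm l 0 c * g)
    (mem_sup_span_singleton.2 ⟨pointForm l 0 c * k, by
      convert pointForm_mul_mem_iff.2 hk using 1
      ring⟩))
  have hcomp := comp_mem hk' j
  rw [comp_sub, comp_zero_mul _ (scaleHom_pointForm_zero l c), comp_comp_self _ hg,
    comp_zero_mul _ hpow] at hcomp
  obtain ⟨q, hq⟩ : pointForm l 0 c ∣ comp j k' := by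
    refine pointForm_dvd_of_vanishing j ((E.filter fun e => e 0 = c).image fun e => e 1) _
      (scaleHom_comp _ _) ?_ ?_
    · rwa [Finset.card_image_of_injOn]
      intro a ha b hb hab
      simp only [Finset.coe_filter, Set.mem_ofPred_eq] at ha hb
      funext i
      fin_cases i
      · exact ha.2.trans hb.2.symm
      · exact hab
    · intro d hd
      obtain ⟨e, he, rfl⟩ := Finset.mem_image.1 hd
      obtain ⟨heE, rfl⟩ := Finset.mem_filter.1 he
      have hee : ![e 0, e 1] = e := by
        funext i
        fin_cases i <;> rfl
      have := mem_pointsIdeal.1 hcomp e (Finset.mem_coe.2 heE)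
      rw [map_sub, map_mul, map_mul, coordHom_pointForm, sub_self, C_0, zero_mul, zero_mul,
        zero_sub, neg_eq_zero, map_pow, coordHom_unitForm] at this
      rw [hee]
      exact (mul_eq_zero.1 this).resolve_left (pow_ne_zero _ (X_ne_zero _))
  refine mem_sup_span_singleton.2 ⟨q, pointForm_mul_mem_iff.1 ?_⟩
  rw [hq] at hcomp
  convert hcomp using 1
  ring

theorem mem_of_homogeneous [DecidableEq K] {l c : K} {E : Finset (Fin 2 → K)}
    (hD : UnitFormsRegular l (E : Set (Fin 2 → K)))
    (hpos : 0 < (E.filter fun e => e 0 = c).card)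
    (hmax : ∀ e ∈ E, (E.filter fun e' => e' 0 = e 0).card ≤ (E.filter fun e' => e' 0 = c).card)
    (j : ℕ) : ∀ (M N : ℕ) (g : R2 K), scaleHom g = Polynomial.C g * Polynomial.X ^ j →
    unitForm l 1 ^ M * g ∈ pointsIdeal l (E.filter fun e => e 0 ≠ c : Finset (Fin 2 → K)) ⊔
      Ideal.span {unitForm l 0 ^ N} →
    g ∈ pointsIdeal l (E.filter fun e => e 0 ≠ c : Finset (Fin 2 → K)) ⊔
      Ideal.span {unitForm l 0 ^ N} := by
  induction j with
  | zero => exact fun M N g hg h => mem_of_lt_card_fiber hD hg hpos h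
  | succ j ih =>
    intro M N g hg h
    rcases lt_or_ge (j + 1) (E.filter fun e => e 0 = c).card with hj | hj
    · exact mem_of_lt_card_fiber hD hg hj h
    obtain ⟨N', g', hg', hmem⟩ := exists_sub_unitForm_mul_mem (l := l)
      (E := E.filter fun e => e 0 ≠ c) (j := j) (fun e he =>
        (Finset.card_le_card (Finset.filter_subset_filter _ (Finset.filter_subset _ _))).trans
          ((hmax e (Finset.mem_filter.1 he).1).trans hj)) hg
    set I := pointsIdeal l (E.filter fun e => e 0 ≠ c : Finset (Fin 2 → K))
    obtain ⟨k, hk⟩ := mem_sup_span_singleton.1 h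
    obtain ⟨q, hq⟩ := mem_sup_span_singleton.1 <| ih (M + 1) (N + N') g' hg' <|
      mem_sup_span_singleton.2 ⟨k, by
        convert I.sub_mem (I.mul_mem_left (unitForm l 0 ^ N') hk)
          (I.mul_mem_left (unitForm l 1 ^ M) hmem) using 1
        ring⟩
    refine mem_sup_span_singleton.2 ⟨unitForm l 1 * q, unitForm_pow_mul_mem (i := 0) (N := N') ?_⟩
    convert I.add_mem hmem (I.mul_mem_left (unitForm l 1) hq) using 1
    ring

theorem UnitFormsRegular.filter_ne [DecidableEq K] {l c : K} {E : Finset (Fin 2 → K)}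
    (hD : UnitFormsRegular l (E : Set (Fin 2 → K)))
    (hpos : 0 < (E.filter fun e => e 0 = c).card)
    (hmax : ∀ e ∈ E, (E.filter fun e' => e' 0 = e 0).card ≤
      (E.filter fun e' => e' 0 = c).card) :
    UnitFormsRegular l (E.filter fun e => e 0 ≠ c : Finset (Fin 2 → K)) := by
  intro M N a ha
  obtain ⟨k, hk⟩ := mem_sup_span_singleton.1 ha
  rw [sum_comp a]
  refine Ideal.sum_mem _ fun j _ => mem_of_homogeneous hD hpos hmax j M N _ (scaleHom_comp _ _) <|
    mem_sup_span_singleton.2 ⟨comp (j + M) k, ?_⟩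
  have := comp_mem hk (j + M)
  rwa [comp_sub, comp_pow_mul _ _ (scaleHom_unitForm_one l),
    comp_zero_mul _ (by rw [map_pow, scaleHom_unitForm_zero, map_pow])] at this

/-! ### Depth -/

theorem coordHom_comp_aeval_unitForm (l : K) (e : Fin 2 → K) :
    (coordHom l e).comp (aeval (unitForm l)) = AlgHom.id K _ := by
  ext1 i
  simp

theorem coordHom_surjective (l : K) (e : Fin 2 → K) : Function.Surjective (coordHom l e) :=
  fun v => ⟨aeval (unitForm l) v, DFunLike.congr_fun (coordHom_comp_aeval_unitForm l e) v⟩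

theorem unitForm_mem_maxIdeal (l : K) (i : Fin 2) : unitForm l i ∈ maxIdeal K 2 (fun _ => 1) :=
  Ideal.add_mem _ (Ideal.subset_span ⟨_, rfl⟩)
    (Ideal.mul_mem_left _ _ (Ideal.subset_span ⟨_, rfl⟩))

theorem pointForm_mem_maxIdeal (l : K) (i : Fin 2) (c : K) :
    pointForm l i c ∈ maxIdeal K 2 (fun _ => 1) :=
  Ideal.sub_mem _ (Ideal.subset_span ⟨_, rfl⟩)
    (Ideal.mul_mem_left _ _ (unitForm_mem_maxIdeal l i))

theorem pointsIdeal_le_maxIdeal (l : K) {E : Set (Fin 2 → K)} (hE : E.Nonempty) :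
    pointsIdeal l E ≤ maxIdeal K 2 (fun _ => 1) := by
  obtain ⟨e, he⟩ := hE
  intro u hu
  obtain ⟨a, k, rfl⟩ := exists_eq_of_coordHom_eq_zero (mem_pointsIdeal.1 hu e he)
  exact Ideal.add_mem _ (Ideal.mul_mem_right _ _ (pointForm_mem_maxIdeal l 0 _))
    (Ideal.mul_mem_right _ _ (pointForm_mem_maxIdeal l 1 _))

theorem UnitFormsRegular.isRegSeqMod {l : K} {E : Set (Fin 2 → K)} (hE : E.Nonempty)
    (hD : UnitFormsRegular l E) :
    IsRegSeqMod K 2 (fun _ => 1) (pointsIdeal l E) [unitForm l 0, unitForm l 1] := by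
  refine ⟨sup_le (pointsIdeal_le_maxIdeal l hE) ?_, ?_⟩
  · rw [Ideal.span_le]
    intro f hf
    have : f = unitForm l 0 ∨ f = unitForm l 1 := by simpa using hf
    rcases this with rfl | rfl <;> exact unitForm_mem_maxIdeal l _
  · intro i
    change Fin 2 at i
    fin_cases i
    · intro G hG
      simpa using unitForm_pow_mul_mem (i := 0) (N := 1) (u := G) (by simpa using hG)
    · intro G hG
      simpa using hD 1 1 G (by simpa using hG)

theorem ringKrullDim_quotient_sup_span_succ_le {A : Type*} [CommRing A] {I : Ideal A} {f : A}
    (hf : ∀ G, f * G ∈ I → G ∈ I) :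
    ringKrullDim (A ⧸ (I ⊔ Ideal.span {f})) + 1 ≤ ringKrullDim (A ⧸ I) := by
  refine ringKrullDim_succ_le_of_surjective
    (Ideal.Quotient.factor (le_sup_left : I ≤ I ⊔ Ideal.span {f}))
    (Ideal.Quotient.factor_surjective _) (r := Ideal.Quotient.mk I f) ?_ ?_
  · rw [mem_nonZeroDivisors_iff_right]
    intro x hx
    obtain ⟨x, rfl⟩ := Ideal.Quotient.mk_surjective x
    rw [← map_mul, Ideal.Quotient.eq_zero_iff_mem] at hx
    rw [Ideal.Quotient.eq_zero_iff_mem]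
    exact hf x (by rwa [mul_comm])
  · rw [Ideal.Quotient.factor_mk, Ideal.Quotient.eq_zero_iff_mem]
    exact Ideal.mem_sup_right (Ideal.mem_span_singleton_self f)

theorem maxIdeal_ne_top : maxIdeal K 2 (fun _ => 1) ≠ ⊤ := by
  intro h
  have hle : maxIdeal K 2 (fun _ => 1) ≤
      RingHom.ker (aeval (R := K) (0 : Sig 2 (fun _ => 1) → K)) := by
    rw [maxIdeal, Ideal.span_le]
    rintro _ ⟨p, rfl⟩
    simp
  rw [h] at hle
  have := hle (Submodule.mem_top (x := (1 : R2 K)))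
  simp at this

theorem IsRegSeqMod.length_le_ringKrullDim {I : Ideal (R2 K)} {L : List (R2 K)}
    (h : IsRegSeqMod K 2 (fun _ => 1) I L) : (L.length : WithBot ℕ∞) ≤ ringKrullDim (R2 K ⧸ I) := by
  obtain ⟨hm, hreg⟩ := h
  have key : ∀ i ≤ L.length,
      ringKrullDim (R2 K ⧸ (I ⊔ Ideal.span {f | f ∈ L.take i})) + i ≤ ringKrullDim (R2 K ⧸ I) := by
    intro i
    induction i with
    | zero =>
      intro _
      have : I ⊔ Ideal.span {f | f ∈ L.take 0} = I := by simp
      rw [this]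
      simp
    | succ i ih =>
      intro hi
      refine le_trans ?_ (ih (by omega))
      have hs : I ⊔ Ideal.span {f | f ∈ L.take (i + 1)} =
          (I ⊔ Ideal.span {f | f ∈ L.take i}) ⊔ Ideal.span {L.get ⟨i, hi⟩} := by
        rw [sup_assoc, ← Ideal.span_union]
        congr 2
        ext f
        change f ∈ L.take (i + 1) ↔ f ∈ L.take i ∨ f = L.get ⟨i, hi⟩
        rw [List.take_succ_eq_append_getElem hi, List.mem_append, List.mem_singleton,
          List.get_eq_getElem]
      have := ringKrullDim_quotient_sup_span_succ_le (hreg ⟨i, hi⟩)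
      rw [hs]
      calc _ = ringKrullDim (R2 K ⧸ ((I ⊔ Ideal.span {f | f ∈ L.take i}) ⊔
              Ideal.span {L.get ⟨i, hi⟩})) + 1 + i := by
            push_cast
            rw [add_assoc, add_comm (1 : WithBot ℕ∞)]
        _ ≤ _ := by gcongr
  have h0 := key _ le_rfl
  rw [List.take_length] at h0
  have : Nontrivial (R2 K ⧸ (I ⊔ Ideal.span {f | f ∈ L})) :=
    Ideal.Quotient.nontrivial_iff.2 fun h => maxIdeal_ne_top (top_le_iff.1 (h ▸ hm))
  calc (L.length : WithBot ℕ∞) = 0 + L.length := (zero_add _).symm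
    _ ≤ _ := by gcongr; exact ringKrullDim_nonneg_of_nontrivial
    _ ≤ _ := h0

theorem ringKrullDim_quotient_pointsIdeal_le (l : K) (E : Finset (Fin 2 → K)) :
    ringKrullDim (R2 K ⧸ pointsIdeal l (E : Set (Fin 2 → K))) ≤ 2 := by
  have hdim : ∀ e, ringKrullDim (R2 K ⧸ RingHom.ker (coordHom l e)) = 2 := by
    intro e
    rw [ringKrullDim_eq_of_ringEquiv
      (Ideal.quotientKerAlgEquivOfSurjective (coordHom_surjective l e)).toRingEquiv,
      MvPolynomial.ringKrullDim_of_isNoetherianRing,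
      ringKrullDim_eq_zero_of_field]
    simp
  rw [ringKrullDim_quotient, Order.krullDim]
  refine iSup_le fun c => ?_
  have hbot : pointsIdeal l (E : Set (Fin 2 → K)) ≤ (c 0).1.asIdeal := (c 0).2
  have hinf : E.inf (fun e => RingHom.ker (coordHom l e)) ≤ (c 0).1.asIdeal := by
    refine le_trans (le_of_eq ?_) hbot
    rw [Finset.inf_eq_iInf, pointsIdeal]
    rfl
  obtain ⟨e, he, hle⟩ := (Ideal.IsPrime.inf_le' (c 0).1.isPrime).1 hinf
  rw [← hdim e, ringKrullDim_quotient]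
  let c' : LTSeries (PrimeSpectrum.zeroLocus (RingHom.ker (coordHom l e) : Set (R2 K))) :=
    { length := c.length
      toFun := fun i => ⟨(c i).1, fun x hx =>
        (show (c 0).1.asIdeal ≤ (c i).1.asIdeal from
          c.monotone (Fin.zero_le i)) (hle hx)⟩
      step := fun i => c.step i }
  exact le_iSup (fun c : LTSeries (PrimeSpectrum.zeroLocus
    (RingHom.ker (coordHom l e) : Set (R2 K))) => (c.length : WithBot ℕ∞)) c'

theorem UnitFormsRegular.hasDepth {l : K} {E : Finset (Fin 2 → K)} (hE : E.Nonempty)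
    (hD : UnitFormsRegular l (E : Set (Fin 2 → K))) :
    hasDepth K 2 (fun _ => 1) (pointsIdeal l (E : Set (Fin 2 → K))) 2 := by
  refine ⟨⟨_, rfl, hD.isRegSeqMod hE⟩, ?_⟩
  rintro _ ⟨L, rfl, hL⟩
  exact_mod_cast hL.length_le_ringKrullDim.trans (ringKrullDim_quotient_pointsIdeal_le l E)

/-! ### Affine coordinates -/

/-- The coordinate of a point of `ℙ^1` in the chart where `x_0 + l x_1` does not vanish. -/
def affineCoord (l : K) (p : Proj1 K) : K := p.rep 1 / (p.rep 0 + l * p.rep 1)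

/-- The coordinates of a point of `ℙ^1 × ℙ^1`. -/
def affineCoords (l : K) (Z : Pt2 K) : Fin 2 → K := fun i => affineCoord l (Z i)

/-- All points of `X` lie in the chart where the forms `x_{i,0} + l x_{i,1}` do not vanish. -/
def InChart (l : K) (X : Set (Pt2 K)) : Prop :=
  ∀ Z ∈ X, ∀ i, (Z i).rep 0 + l * (Z i).rep 1 ≠ 0

theorem rep_eq_mul {l : K} {p : Proj1 K} (hp : p.rep 0 + l * p.rep 1 ≠ 0) (j : Fin 2) :
    p.rep j = (if j = 0 then 1 - l * affineCoord l p else affineCoord l p) *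
      (p.rep 0 + l * p.rep 1) := by
  have h : affineCoord l p * (p.rep 0 + l * p.rep 1) = p.rep 1 := div_mul_cancel₀ _ hp
  fin_cases j
  · simp only [Fin.zero_eta, if_true]
    linear_combination l * h
  · simpa using h.symm

theorem affineCoord_inj {l : K} {p q : Proj1 K} (hp : p.rep 0 + l * p.rep 1 ≠ 0)
    (hq : q.rep 0 + l * q.rep 1 ≠ 0) (h : affineCoord l p = affineCoord l q) : p = q := by
  rw [← p.mk_rep, ← q.mk_rep, Projectivization.mk_eq_mk_iff']
  refine ⟨(p.rep 0 + l * p.rep 1) * (q.rep 0 + l * q.rep 1)⁻¹, funext fun j => ?_⟩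
  have hp' := rep_eq_mul hp j
  have hq' := rep_eq_mul hq j
  rw [Pi.smul_apply, smul_eq_mul, hp', h, mul_assoc, inv_mul_eq_div, div_eq_of_eq_mul hq hq',
    mul_comm]

theorem idealOfPoint_eq_ker_s17 [Infinite K] {l : K} {Z : Pt2 K}
    (hZ : ∀ i, (Z i).rep 0 + l * (Z i).rep 1 ≠ 0) :
    idealOfPoint K 2 (fun _ => 1) Z = RingHom.ker (coordHom l (affineCoords l Z)) := by
  have heval : ∀ (y : Fin 2 → K) (u : R2 K), eval y (coordHom l (affineCoords l Z) u) =
      eval (fun p => (if p.2 = 0 then 1 - l * affineCoord l (Z p.1) else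
        affineCoord l (Z p.1)) * y p.1) u := by
    intro y u
    have : (aeval (R := K) y).comp (coordHom l (affineCoords l Z)) =
        aeval (fun p => (if p.2 = 0 then 1 - l * affineCoord l (Z p.1) else
          affineCoord l (Z p.1)) * y p.1) := by
      ext1 p
      simp [coordHom, affineCoords]
    exact DFunLike.congr_fun this u
  ext u
  simp only [idealOfPoint, vanishingIdeal, Submodule.mem_iInf, RingHom.mem_ker]
  constructor
  · intro h
    refine MvPolynomial.funext fun y => ?_
    rw [map_zero, heval]
    refine h _ fun i => ⟨y i * ((Z i).rep 0 + l * (Z i).rep 1)⁻¹, funext fun j => ?_⟩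
    rw [Pi.smul_apply, smul_eq_mul, mul_assoc, inv_mul_eq_div,
      div_eq_of_eq_mul (hZ i) (rep_eq_mul (hZ i) j), mul_comm]
  · intro h x hx
    choose y hy using hx
    have := heval (fun i => y i * ((Z i).rep 0 + l * (Z i).rep 1)) u
    rw [h, map_zero] at this
    rw [this]
    congr 2
    funext ⟨i, j⟩
    rw [show x ⟨i, j⟩ = y i * (Z i).rep j from congrFun (hy i) j, rep_eq_mul (hZ i) j]
    ring

theorem idealOfSet_eq_pointsIdeal [Infinite K] {l : K} {X : Set (Pt2 K)} (hX : InChart l X) :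
    idealOfSet K 2 (fun _ => 1) X = pointsIdeal l (affineCoords l '' X) := by
  rw [idealOfSet, pointsIdeal, iInf_image]
  exact iInf_congr fun Z => iInf_congr fun hZ => idealOfPoint_eq_ker_s17 (hX Z hZ)

theorem exists_inChart [Infinite K] {X : Set (Pt2 K)} (hX : X.Finite) : ∃ l : K, InChart l X := by
  have hfin : (⋃ Z ∈ X, ⋃ i : Fin 2, {l : K | (Z i).rep 0 + l * (Z i).rep 1 = 0}).Finite := by
    refine hX.biUnion fun Z _ => Set.finite_iUnion fun i => ?_
    refine (Set.finite_singleton (-(Z i).rep 0 / (Z i).rep 1)).subset fun l hl => ?_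
    have hl : (Z i).rep 0 + l * (Z i).rep 1 = 0 := hl
    have h1 : (Z i).rep 1 ≠ 0 := by
      intro h1
      refine (Z i).rep_nonzero ?_
      funext j
      fin_cases j
      · simpa [h1] using hl
      · exact h1
    rw [Set.mem_singleton_iff, eq_div_iff h1]
    linear_combination hl
  obtain ⟨l, hl⟩ := hfin.infinite_compl.nonempty
  refine ⟨l, fun Z hZ i h => hl ?_⟩
  simp only [Set.mem_iUnion]
  exact ⟨Z, hZ, i, h⟩

theorem InChart.injOn {l : K} {X : Set (Pt2 K)} (hX : InChart l X) :
    Set.InjOn (affineCoords l) X := fun Z hZ Z' hZ' h =>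
  funext fun i => affineCoord_inj (hX Z hZ i) (hX Z' hZ' i) (congrFun h i)

theorem unitFormsRegular_image_of_isACM [IsAlgClosed K] {l : K} {X : Set (Pt2 K)}
    (hX : X.Finite) (hl : InChart l X) (h : IsACM K 2 (fun _ => 1) X) :
    UnitFormsRegular l (affineCoords l '' X) := by
  classical
  obtain ⟨⟨L, hL, hreg⟩, -⟩ := h
  rw [idealOfSet_eq_pointsIdeal hl] at hreg
  lift X to Finset (Pt2 K) using hX
  rw [← Finset.coe_image] at hreg ⊢
  exact unitFormsRegular_of_isRegSeqMod hL hreg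

theorem isACM_of_unitFormsRegular_image [Infinite K] {l : K} {X : Set (Pt2 K)}
    (hX : X.Finite) (hne : X.Nonempty) (hl : InChart l X)
    (h : UnitFormsRegular l (affineCoords l '' X)) : IsACM K 2 (fun _ => 1) X := by
  classical
  rw [IsACM, idealOfSet_eq_pointsIdeal hl]
  lift X to Finset (Pt2 K) using hX
  rw [← Finset.coe_image] at h ⊢
  exact h.hasDepth (Finset.Nonempty.image hne _)

theorem UnitFormsRegular.image_sep_ne {l : K} {Y : Set (Pt2 K)} (hY : Y.Finite)
    (hl : InChart l Y) {W : Pt2 K} (hW : W ∈ Y)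
    (hmax : ∀ Z ∈ Y, {Z' | Z' ∈ Y ∧ Z' 0 = Z 0}.ncard ≤ {Z' | Z' ∈ Y ∧ Z' 0 = W 0}.ncard)
    (h : UnitFormsRegular l (affineCoords l '' Y)) :
    UnitFormsRegular l (affineCoords l '' {Z | Z ∈ Y ∧ Z 0 ≠ W 0}) := by
  classical
  have hiff : ∀ Z ∈ Y, ∀ Z' ∈ Y, affineCoords l Z' 0 = affineCoord l (Z 0) ↔ Z' 0 = Z 0 :=
    fun Z hZ Z' hZ' => ⟨affineCoord_inj (hl Z' hZ' 0) (hl Z hZ 0), fun h => congrArg _ h⟩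
  lift Y to Finset (Pt2 K) using hY
  simp only [Finset.mem_coe] at *
  rw [← Finset.coe_image] at h
  have hcard : ∀ Z ∈ Y, ((Y.image (affineCoords l)).filter
      fun e => e 0 = affineCoord l (Z 0)).card = {Z' | Z' ∈ Y ∧ Z' 0 = Z 0}.ncard := by
    intro Z hZ
    rw [Finset.filter_image, Finset.card_image_of_injOn (hl.injOn.mono (Finset.filter_subset _ _)),
      Finset.filter_congr (hiff Z hZ), ← Set.ncard_coe_finset, Finset.coe_filter]
  have := h.filter_ne (c := affineCoord l (W 0)) ?_ ?_
  · rw [Finset.filter_image, Finset.filter_congr fun Z hZ => not_congr (hiff W hW Z hZ),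
      Finset.coe_image, Finset.coe_filter] at this
    exact this
  · rw [Finset.card_pos]
    exact ⟨_, Finset.mem_filter.2 ⟨Finset.mem_image_of_mem _ hW, rfl⟩⟩
  · intro e he
    obtain ⟨Z, hZ, rfl⟩ := Finset.mem_image.1 he
    exact (hcard Z hZ).trans_le ((hmax Z hZ).trans_eq (hcard W hW).symm)

end

end PaperMP

namespace PaperMP

/-- removing the fibers of the first `i` (largest) first coordinates
from an ACM set of points of `ℙ^1 × ℙ^1` leaves an ACM set of points, with
`α_{X_i} = (α_{i+1},…,α_t)`. -/
theorem statement_17 (K : Type) [Field K] [IsAlgClosed K] [CharZero K]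
    (X : Set (Pt2 K)) (hX : X.Finite) (t : ℕ)
    (P : Fin t → Proj1 K) (α : Fin t → ℕ) (hα : IsAlphaLabel K X P α)
    (hACM : IsACM K 2 (fun _ => 1) X) :
    ∀ i : ℕ, i < t →
      IsACM K 2 (fun _ => 1) {Z | Z ∈ X ∧ ∀ m : Fin t, (m : ℕ) < i → Z 0 ≠ P m} ∧
      IsAlphaLabel K {Z | Z ∈ X ∧ ∀ m : Fin t, (m : ℕ) < i → Z 0 ≠ P m}
        (fun j : Fin (t - i) => P ⟨i + (j : ℕ), by have := j.isLt; omega⟩)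
        (fun j : Fin (t - i) => α ⟨i + (j : ℕ), by have := j.isLt; omega⟩) := by
  obtain ⟨hinj, hrange, hcard, hanti⟩ := hα
  have hmemP : ∀ Z ∈ X, ∃ m, P m = Z 0 := fun Z hZ => by
    have : Z 0 ∈ Set.range P := hrange ▸ Set.mem_image_of_mem _ hZ
    exact this
  have hex : ∀ m, ∃ Z ∈ X, Z 0 = P m := fun m => by
    have : P m ∈ (fun Z : Pt2 K => Z 0) '' X := hrange ▸ Set.mem_range_self m
    exact this
  have hmem : ∀ (i : ℕ) (m : Fin t) (Z : Pt2 K), Z 0 = P m →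
      (Z ∈ {Z | Z ∈ X ∧ ∀ m : Fin t, (m : ℕ) < i → Z 0 ≠ P m} ↔ Z ∈ X ∧ i ≤ m) := by
    refine fun i m Z hZ => and_congr_right fun _ => ⟨fun h => ?_, fun h m' hm' heq => ?_⟩
    · by_contra! hlt
      exact h m hlt hZ
    · rw [hinj (hZ.symm.trans heq)] at h
      omega
  have hfiber : ∀ (i : ℕ) (m : Fin t), i ≤ m →
      {Z | Z ∈ {Z | Z ∈ X ∧ ∀ m : Fin t, (m : ℕ) < i → Z 0 ≠ P m} ∧ Z 0 = P m}.ncard = α m := by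
    intro i m hm
    rw [hcard]
    congr 1
    ext Z
    exact and_congr_left fun hZ => (hmem i m Z hZ).trans (and_iff_left hm)
  obtain ⟨l, hl⟩ := exists_inChart hX
  have hsub : ∀ i : ℕ, {Z | Z ∈ X ∧ ∀ m : Fin t, (m : ℕ) < i → Z 0 ≠ P m} ⊆ X :=
    fun i Z hZ => hZ.1
  have hreg : ∀ i ≤ t, UnitFormsRegular l
      (affineCoords l '' {Z | Z ∈ X ∧ ∀ m : Fin t, (m : ℕ) < i → Z 0 ≠ P m}) := by
    intro i
    induction i with
    | zero =>
      intro _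
      simpa using unitFormsRegular_image_of_isACM hX hl hACM
    | succ i ih =>
      intro hi
      obtain ⟨W, hWX, hW⟩ := hex ⟨i, hi⟩
      have hstep : {Z | Z ∈ X ∧ ∀ m : Fin t, (m : ℕ) < i + 1 → Z 0 ≠ P m} =
          {Z | Z ∈ {Z | Z ∈ X ∧ ∀ m : Fin t, (m : ℕ) < i → Z 0 ≠ P m} ∧ Z 0 ≠ W 0} := by
        ext Z
        constructor
        · exact fun h => ⟨⟨h.1, fun m hm => h.2 m (by omega)⟩,
            hW ▸ h.2 ⟨i, hi⟩ (Nat.lt_succ_self i)⟩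
        · rintro ⟨⟨hZ, h⟩, hne⟩
          refine ⟨hZ, fun m hm => ?_⟩
          rcases Nat.lt_succ_iff_lt_or_eq.1 hm with hm | hm
          · exact h m hm
          · rwa [show m = ⟨i, hi⟩ from Fin.ext hm, ← hW]
      rw [hstep]
      refine (ih (by omega)).image_sep_ne (hX.subset (hsub i)) (fun Z hZ => hl Z hZ.1)
        ((hmem i _ W hW).2 ⟨hWX, le_rfl⟩) ?_
      intro Z hZ
      obtain ⟨m, hm⟩ := hmemP Z hZ.1
      have him := ((hmem i m Z hm.symm).1 hZ).2
      rw [hW, ← hm, hfiber i m him, hfiber i ⟨i, hi⟩ le_rfl]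
      exact hanti him
  intro i hi
  refine ⟨isACM_of_unitFormsRegular_image (hX.subset (hsub i)) ?_ (fun Z hZ => hl Z hZ.1)
    (hreg i hi.le), ?_, ?_, ?_, ?_⟩
  · obtain ⟨W, hWX, hW⟩ := hex ⟨i, hi⟩
    exact ⟨W, (hmem i _ W hW).2 ⟨hWX, le_rfl⟩⟩
  · intro a b hab
    have := congrArg Fin.val (hinj hab)
    exact Fin.ext (by simpa using this)
  · ext p
    constructor
    · rintro ⟨j, rfl⟩
      obtain ⟨W, hWX, hW⟩ := hex ⟨i + j, by omega⟩
      exact ⟨W, (hmem i _ W hW).2 ⟨hWX, Nat.le_add_right _ _⟩, hW⟩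
    · rintro ⟨Z, hZ, rfl⟩
      obtain ⟨m, hm⟩ := hmemP Z hZ.1
      have him := ((hmem i m Z hm.symm).1 hZ).2
      refine ⟨⟨m - i, by omega⟩, ?_⟩
      simp only [Nat.add_sub_cancel' him, hm]
  · exact fun j => (hfiber i _ (Nat.le_add_right _ _)).symm
  · exact fun a b hab => hanti (Nat.add_le_add_left hab i)

end PaperMP
end
end

section
/- Suppose X is an ACM set of distinct points in ℙ^1 × ℙ^1 with α_X = (α_1,…,α_t). Define C_X = {(t,0), (0,α_1)} ∪ {(i−1, α_i) : α_i − α_{i−1} < 0} and V_X = {(t, α_t)} ∪ {(i−1, α_{i−1}) : α_i − α_{i−1} < 0}. Then the graded minimal free resolution of I_X is 0 → ⊕_{(v_1,v_2) ∈ V_X} R(−v_1,−v_2) → ⊕_{(c_1,c_2) ∈ C_X} R(−c_1,−c_2) → I_X → 0; in particular there is an exact sequence of ℕ²-graded R-modules with degree-(0,0) maps of this form. -/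
open MvPolynomial

noncomputable section

namespace PaperMP

section BilinearForms

variable {K : Type} [Field K]

/-- The linear form in the `i`-th set of variables vanishing at `p`. -/
def lin (i : Fin 2) (p : Proj1 K) : R2 K :=
  C (p.rep 1) * X ⟨i, (0 : Fin 2)⟩ - C (p.rep 0) * X ⟨i, (1 : Fin 2)⟩

/-- The determinant of the chosen representatives of two points of `ℙ^1`. -/
def cross (p q : Proj1 K) : K := p.rep 1 * q.rep 0 - p.rep 0 * q.rep 1

/-- Restriction of polynomials to the cone over `Z`, parametrised by two scalars. -/
def restr (Z : Pt2 K) : R2 K →ₐ[K] MvPolynomial (Fin 2) K :=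
  aeval fun x => C ((Z x.1).rep x.2) * X x.1

lemma exists_dual_s18 (p : Proj1 K) : ∃ a b : K, a * p.rep 0 + b * p.rep 1 = 1 := by
  by_cases h : p.rep 0 = 0
  · have h1 : p.rep 1 ≠ 0 := by
      intro h1
      exact p.rep_nonzero (by ext j; fin_cases j <;> assumption)
    exact ⟨0, (p.rep 1)⁻¹, by simp [h1]⟩
  · exact ⟨(p.rep 0)⁻¹, 0, by simp [h]⟩

lemma cross_eq_zero {p q : Proj1 K} : cross p q = 0 ↔ p = q := by
  constructor
  · intro h
    obtain ⟨a, b, hab⟩ := exists_dual_s18 q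
    rw [← p.mk_rep, ← q.mk_rep, Projectivization.mk_eq_mk_iff']
    refine ⟨a * p.rep 0 + b * p.rep 1, ?_⟩
    unfold cross at h
    ext j
    fin_cases j
    · simp only [Pi.smul_apply, smul_eq_mul, Fin.zero_eta]
      linear_combination p.rep 0 * hab + b * h
    · simp only [Pi.smul_apply, smul_eq_mul, Fin.mk_one]
      linear_combination p.rep 1 * hab - a * h
  · rintro rfl
    unfold cross; ring

lemma restr_lin (Z : Pt2 K) (i : Fin 2) (p : Proj1 K) :
    restr Z (lin i p) = C (cross p (Z i)) * X i := by
  simp only [restr, lin, cross, map_sub, map_mul, aeval_X, algHom_C, algebraMap_eq]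
  ring

lemma restr_lin_eq_zero {Z : Pt2 K} {i : Fin 2} {p : Proj1 K} :
    restr Z (lin i p) = 0 ↔ p = Z i := by
  rw [restr_lin, ← cross_eq_zero]
  simp [X_ne_zero]

lemma restr_prod_lin (Z : Pt2 K) (i : Fin 2) (S : Finset (Proj1 K)) :
    restr Z (∏ p ∈ S, lin i p) = C (∏ p ∈ S, cross p (Z i)) * X i ^ S.card := by
  simp [restr_lin, Finset.prod_mul_distrib]

lemma restr_prod_lin_eq_zero {Z : Pt2 K} {i : Fin 2} {S : Finset (Proj1 K)} :
    restr Z (∏ p ∈ S, lin i p) = 0 ↔ Z i ∈ S := by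
  rw [map_prod, Finset.prod_eq_zero_iff]
  simp [restr_lin_eq_zero]

lemma mem_idealOfSet_s18 [Infinite K] {X : Set (Pt2 K)} {f : R2 K} :
    f ∈ idealOfSet K 2 (fun _ => 1) X ↔ ∀ Z ∈ X, restr Z f = 0 := by
  have hcomp : ∀ (Z : Pt2 K) (s : Fin 2 → K),
      eval s (restr Z f) = eval (fun x => (Z x.1).rep x.2 * s x.1) f := by
    intro Z s
    have : ((aeval s : MvPolynomial (Fin 2) K →ₐ[K] K).comp (restr Z)) =
        aeval (fun x : Sig 2 (fun _ => 1) => (Z x.1).rep x.2 * s x.1) := by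
      ext x
      simp [restr]
    have h := DFunLike.congr_fun this f
    simpa [aeval_eq_eval] using h
  simp only [idealOfSet, idealOfPoint, vanishingIdeal, Ideal.mem_iInf, RingHom.mem_ker]
  refine forall₂_congr fun Z _ => ⟨fun h => ?_, fun h x hx => ?_⟩
  · refine MvPolynomial.funext fun s => ?_
    rw [hcomp, map_zero]
    refine h _ fun i => ⟨s i, ?_⟩
    ext j
    simp [mul_comm]
  · choose s hs using hx
    have hx' : x = fun y : Sig 2 (fun _ => 1) => (Z y.1).rep y.2 * s y.1 := by
      ext ⟨i, j⟩
      have := congrFun (hs i) j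
      simpa [mul_comm] using this
    rw [hx', ← hcomp, h, map_zero]

lemma mem_span_of_restr_eq_zero {Z : Pt2 K} {f : R2 K} (hf : restr Z f = 0)
    {i j : Fin 2} (hij : i ≠ j) :
    ∃ g h, f = lin j (Z j) * g + lin i (Z i) * h := by
  choose a b hab using fun i => exists_dual_s18 (Z i)
  let σ : MvPolynomial (Fin 2) K →ₐ[K] R2 K :=
    aeval fun l => C (a l) * X ⟨l, (0 : Fin 2)⟩ + C (b l) * X ⟨l, (1 : Fin 2)⟩
  let J : Ideal (R2 K) := Ideal.span {lin j (Z j), lin i (Z i)}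
  have hJ : ∀ l, lin l (Z l) ∈ J := by
    intro l
    have : l = j ∨ l = i := by omega
    rcases this with rfl | rfl <;> exact Ideal.subset_span (by simp)
  have hcong : (Ideal.Quotient.mkₐ K J).comp (σ.comp (restr Z)) = Ideal.Quotient.mkₐ K J := by
    refine MvPolynomial.algHom_ext fun x => ?_
    obtain ⟨l, m⟩ := x
    have hC : C (a l) * C ((Z l).rep 0) + C (b l) * C ((Z l).rep 1) = (1 : R2 K) := by
      rw [← C_mul, ← C_mul, ← C_add, hab, C_1]
    simp only [AlgHom.comp_apply, Ideal.Quotient.mkₐ_eq_mk]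
    rw [Ideal.Quotient.eq]
    simp only [restr, aeval_X, map_mul, algHom_C, algebraMap_eq, σ]
    fin_cases m
    · have : lin l (Z l) * (- C (b l)) ∈ J := J.mul_mem_right _ (hJ l)
      convert this using 1
      simp only [lin, Fin.zero_eta]
      linear_combination X ⟨l, (0 : Fin 2)⟩ * hC
    · have : lin l (Z l) * C (a l) ∈ J := J.mul_mem_right _ (hJ l)
      convert this using 1
      simp only [lin, Fin.mk_one]
      linear_combination X ⟨l, (1 : Fin 2)⟩ * hC
  have h0 := DFunLike.congr_fun hcong f
  simp only [AlgHom.comp_apply, hf, map_zero, Ideal.Quotient.mkₐ_eq_mk] at h0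
  have hfJ : f ∈ J := Ideal.Quotient.eq_zero_iff_mem.1 h0.symm
  obtain ⟨g, h, hgh⟩ := Ideal.mem_span_pair.1 hfJ
  exact ⟨g, h, by rw [← hgh]; ring⟩

lemma exists_eq_lin_mul_add_prod_mul {i j : Fin 2} (hij : i ≠ j) (Z : Pt2 K) (f : R2 K)
    (S : Finset (Proj1 K)) (hf : ∀ q ∈ S, restr (Function.update Z i q) f = 0) :
    ∃ g h, f = lin j (Z j) * g + (∏ q ∈ S, lin i q) * h := by
  classical
  induction S using Finset.induction_on with
  | empty => exact ⟨0, f, by simp⟩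
  | insert q S hq ih =>
    obtain ⟨g, h, hgh⟩ := ih fun q' hq' => hf q' (Finset.mem_insert_of_mem hq')
    have h0 := hf q (Finset.mem_insert_self _ _)
    have hj : Function.update Z i q j = Z j := Function.update_of_ne hij.symm _ _
    rw [hgh, map_add, map_mul, map_mul, restr_lin_eq_zero.2 hj.symm, zero_mul, zero_add,
      mul_eq_zero, restr_prod_lin_eq_zero, Function.update_self] at h0
    obtain ⟨g', h', hh⟩ := mem_span_of_restr_eq_zero (h0.resolve_left hq) hij
    rw [hj, Function.update_self] at hh
    refine ⟨g + (∏ q ∈ S, lin i q) * g', h', ?_⟩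
    rw [Finset.prod_insert hq, hgh, hh]
    ring

/-- A polynomial with more zeros on a ruling than its degree there has no coefficient in
that degree. -/
lemma coeff_restr_eq_zero {i j : Fin 2} (hij : i ≠ j) (Z : Pt2 K) (f : R2 K)
    (S : Finset (Proj1 K)) (hf : ∀ q ∈ S, restr (Function.update Z i q) f = 0)
    {d : Fin 2 →₀ ℕ} (hd : d i < S.card) : coeff d (restr Z f) = 0 := by
  obtain ⟨g, h, rfl⟩ := exists_eq_lin_mul_add_prod_mul hij Z f S hf
  rw [map_add, map_mul, map_mul, restr_lin_eq_zero.2 rfl, zero_mul, zero_add, restr_prod_lin,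
    mul_assoc, coeff_C_mul, X_pow_eq_monomial, coeff_monomial_mul', if_neg, mul_zero]
  intro hle
  have := hle i
  simp at this
  omega

lemma restr_monomial (Z : Pt2 K) (m : Sig 2 (fun _ => 1) →₀ ℕ) (r : K) :
    restr Z (monomial m r) =
      monomial (Finsupp.equivFunOnFinite.symm (Finsupp.weight (wt 2 (fun _ => 1)) m))
        (r * ∏ x ∈ m.support, (Z x.1).rep x.2 ^ m x) := by
  rw [monomial_eq, monomial_eq, map_mul, algHom_C, Finsupp.prod, map_prod]
  simp only [map_pow, restr, aeval_X, mul_pow, Finset.prod_mul_distrib, algebraMap_eq, C_mul]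
  rw [mul_assoc, map_prod]
  congr 2
  · simp
  · rw [Finsupp.weight_apply, Finsupp.prod_fintype _ _ (by simp), Finsupp.sum]
    simp only [Finsupp.equivFunOnFinite_symm_apply_apply, Finset.sum_apply, Pi.smul_apply,
      ← Finset.prod_pow_eq_pow_sum]
    rw [Finset.prod_comm]
    refine Finset.prod_congr rfl fun x _ => ?_
    rw [Finset.prod_eq_single x.1]
    · simp [wt]
    · intro l _ hl
      simp [wt, Pi.single_eq_of_ne hl]
    · simp

lemma restr_weightedHomogeneousComponent (Z : Pt2 K) (f : R2 K) (d : Fin 2 → ℕ) :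
    restr Z (weightedHomogeneousComponent (wt 2 (fun _ => 1)) d f) =
      monomial (Finsupp.equivFunOnFinite.symm d)
        (coeff (Finsupp.equivFunOnFinite.symm d) (restr Z f)) := by
  classical
  induction f using MvPolynomial.induction_on' with
  | monomial m r =>
    rw [weightedHomogeneousComponent_of_mem
      (isWeightedHomogeneous_monomial (wt 2 (fun _ => 1)) m r rfl), restr_monomial, coeff_monomial]
    by_cases h : d = Finsupp.weight (wt 2 (fun _ => 1)) m
    · simp [h, restr_monomial]
    · simp [h, Ne.symm h]
  | add p q hp hq => simp only [map_add, coeff_add, hp, hq]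

/-! ### Depth -/

/-- The family `φ` of functions on the cones over the points of `X` is induced by a polynomial. -/
def IsPoly (X : Set (Pt2 K)) (φ : Pt2 K → MvPolynomial (Fin 2) K) : Prop :=
  ∃ g : R2 K, ∀ Z ∈ X, restr Z g = φ Z

/-- The polynomials `f` for which `f * φ` is induced by a polynomial. -/
def multipliers (X : Set (Pt2 K)) (φ : Pt2 K → MvPolynomial (Fin 2) K) : Ideal (R2 K) where
  carrier := {f | IsPoly X fun Z => restr Z f * φ Z}
  zero_mem' := ⟨0, by simp⟩
  add_mem' := by
    rintro f g ⟨F, hF⟩ ⟨G, hG⟩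
    refine ⟨F + G, fun Z hZ => ?_⟩
    beta_reduce
    rw [map_add, hF Z hZ, hG Z hZ, map_add, add_mul]
  smul_mem' := by
    rintro r f ⟨F, hF⟩
    refine ⟨r * F, fun Z hZ => ?_⟩
    beta_reduce
    rw [map_mul, hF Z hZ, smul_eq_mul, map_mul, mul_assoc]

lemma isPoly_of_forall_X_mul [Infinite K] {X : Set (Pt2 K)}
    {L : List (R2 K)} (hL : L.length = 2)
    (hreg : IsRegSeqMod K 2 (fun _ => 1) (idealOfSet K 2 (fun _ => 1) X) L)
    {φ : Pt2 K → MvPolynomial (Fin 2) K}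
    (hφ : ∀ x, IsPoly X fun Z => restr Z (MvPolynomial.X x) * φ Z) : IsPoly X φ := by
  obtain ⟨L₁, L₂, rfl⟩ := List.length_eq_two.1 hL
  obtain ⟨hm, hreg⟩ := hreg
  set I := idealOfSet K 2 (fun _ => 1) X with hI
  have hmem : ∀ f ∈ maxIdeal K 2 (fun _ => 1), IsPoly X fun Z => restr Z f * φ Z := by
    have hle : maxIdeal K 2 (fun _ => 1) ≤ multipliers X φ := by
      rw [maxIdeal, Ideal.span_le]
      rintro _ ⟨x, rfl⟩
      exact hφ x
    exact fun f hf => hle hf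
  have h₁ : L₁ ∈ maxIdeal K 2 (fun _ => 1) :=
    hm (Ideal.mem_sup_right (Ideal.subset_span (by simp)))
  have h₂ : L₂ ∈ maxIdeal K 2 (fun _ => 1) :=
    hm (Ideal.mem_sup_right (Ideal.subset_span (by simp)))
  have hreg₁ : ∀ G, L₁ * G ∈ I → G ∈ I := by
    intro G hG
    simpa using hreg ⟨0, by simp⟩ G (by simpa using hG)
  have hreg₂ : ∀ G, L₂ * G ∈ I ⊔ Ideal.span {L₁} → G ∈ I ⊔ Ideal.span {L₁} := by
    intro G hG
    simpa using hreg ⟨1, by simp⟩ G (by simpa using hG)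
  obtain ⟨a, ha⟩ := hmem L₁ h₁
  obtain ⟨b, hb⟩ := hmem L₂ h₂
  have hab : L₂ * a - L₁ * b ∈ I := by
    rw [hI, mem_idealOfSet_s18]
    intro Z hZ
    rw [map_sub, map_mul, map_mul, ha Z hZ, hb Z hZ]
    ring
  have haI : a ∈ I ⊔ Ideal.span {L₁} := by
    apply hreg₂
    have := add_mem (Ideal.mem_sup_left (T := Ideal.span {L₁}) hab)
      (Ideal.mem_sup_right (S := I) (Ideal.mem_span_singleton.2 (dvd_mul_right L₁ b)))
    simpa using this
  obtain ⟨u, hu, w, hw, rfl⟩ := Submodule.mem_sup.1 haI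
  obtain ⟨c, rfl⟩ := Ideal.mem_span_singleton.1 hw
  rw [hI, mem_idealOfSet_s18] at hu
  refine ⟨c, fun Z hZ => ?_⟩
  obtain ⟨x, hx⟩ : ∃ x, restr Z (MvPolynomial.X x) ≠ 0 := by
    obtain ⟨s, hs⟩ := Function.ne_iff.1 (Z 0).rep_nonzero
    refine ⟨⟨0, s⟩, ?_⟩
    simpa [restr, X_ne_zero] using hs
  obtain ⟨F, hF⟩ := hφ x
  have hFI : MvPolynomial.X x * c - F ∈ I := by
    apply hreg₁
    rw [hI, mem_idealOfSet_s18]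
    intro Z hZ
    have h1 := ha Z hZ
    rw [map_add, map_mul, hu Z hZ, zero_add] at h1
    rw [map_mul, map_sub, map_mul, hF Z hZ]
    linear_combination restr Z (MvPolynomial.X x) * h1
  rw [hI, mem_idealOfSet_s18] at hFI
  have h2 := hFI Z hZ
  rw [map_sub, map_mul, hF Z hZ, ← mul_sub, mul_eq_zero] at h2
  exact sub_eq_zero.1 (h2.resolve_left hx)

lemma isPoly_of_maxIdeal_le_radical [Infinite K] {X : Set (Pt2 K)}
    {L : List (R2 K)} (hL : L.length = 2)
    (hreg : IsRegSeqMod K 2 (fun _ => 1) (idealOfSet K 2 (fun _ => 1) X) L)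
    {φ : Pt2 K → MvPolynomial (Fin 2) K}
    (hφ : ∀ 𝔭 : Ideal (R2 K), 𝔭.IsPrime → (∀ f, (IsPoly X fun Z => restr Z f * φ Z) → f ∈ 𝔭) →
      ∀ x, MvPolynomial.X x ∈ 𝔭) : IsPoly X φ := by
  set J := multipliers X φ
  have hrad : maxIdeal K 2 (fun _ => 1) ≤ J.radical := by
    rw [Ideal.radical_eq_sInf]
    refine le_sInf ?_
    rintro 𝔭 ⟨hJ, hp⟩
    rw [maxIdeal, Ideal.span_le]
    rintro _ ⟨x, rfl⟩
    exact hφ 𝔭 hp (fun f hf => hJ hf) x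
  obtain ⟨n, hn⟩ := Ideal.exists_pow_le_of_le_radical_of_fg hrad (IsNoetherian.noetherian _)
  have hone : ∀ n, maxIdeal K 2 (fun _ => 1) ^ n ≤ J → (1 : R2 K) ∈ J := by
    intro n
    induction n with
    | zero => intro h; exact h (by simp)
    | succ n ih =>
      intro h
      refine ih fun r hr => ?_
      refine isPoly_of_forall_X_mul hL hreg fun x => ?_
      have hx : MvPolynomial.X x * r ∈ J := h (by
        rw [pow_succ']
        exact Ideal.mul_mem_mul (Ideal.subset_span ⟨x, rfl⟩) hr)
      have hx' : IsPoly X fun Z => restr Z (MvPolynomial.X x * r) * φ Z := hx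
      simpa only [map_mul, mul_assoc] using hx'
  have : IsPoly X fun Z => restr Z 1 * φ Z := hone n hn
  simpa using this

lemma X_mem_of_prod_lin_mem {𝔭 : Ideal (R2 K)} (hp : 𝔭.IsPrime) {i : Fin 2}
    [DecidableEq (Proj1 K)] {Q : Finset (Proj1 K)} (hQ : Q.Nonempty)
    (h : ∀ q ∈ Q, ∏ q' ∈ Q.erase q, lin i q' ∈ 𝔭) (j : Fin 2) :
    (MvPolynomial.X ⟨i, j⟩ : R2 K) ∈ 𝔭 := by
  obtain ⟨q₀, hq₀⟩ := hQ
  obtain ⟨p, hpQ, hp𝔭⟩ := hp.prod_mem_iff.1 (h q₀ hq₀)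
  obtain ⟨q, hqQ, hq𝔭⟩ := hp.prod_mem_iff.1 (h p (Finset.mem_of_mem_erase hpQ))
  have hne : cross p q ≠ 0 := fun h0 => Finset.ne_of_mem_erase hqQ (cross_eq_zero.1 h0).symm
  have hC : C (cross p q)⁻¹ * (C (p.rep 1) * C (q.rep 0) - C (p.rep 0) * C (q.rep 1)) =
      (1 : R2 K) := by
    rw [← C_mul, ← C_mul, ← C_sub, ← C_mul]
    change C ((cross p q)⁻¹ * cross p q) = 1
    rw [inv_mul_cancel₀ hne, C_1]
  have hj : ∀ c : K, C (cross p q)⁻¹ * (C (q.rep j) * lin i p - C (p.rep j) * lin i q) ∈ 𝔭 :=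
    fun c => 𝔭.mul_mem_left _ (sub_mem (𝔭.mul_mem_left _ hp𝔭) (𝔭.mul_mem_left _ hq𝔭))
  convert hj 0 using 1
  fin_cases j
  · simp only [lin, Fin.zero_eta]
    linear_combination - X ⟨i, (0 : Fin 2)⟩ * hC
  · simp only [lin, Fin.mk_one]
    linear_combination - X ⟨i, (1 : Fin 2)⟩ * hC

/-- If `X` has depth two then its vertical fibres `S p` are nested. -/
lemma fiber_subset_of_card_le [Infinite K] {X : Set (Pt2 K)}
    {L : List (R2 K)} (hL : L.length = 2)
    (hreg : IsRegSeqMod K 2 (fun _ => 1) (idealOfSet K 2 (fun _ => 1) X) L)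
    {A : Finset (Proj1 K)} {S : Proj1 K → Finset (Proj1 K)}
    (hX : ∀ Z : Pt2 K, Z ∈ X ↔ Z 0 ∈ A ∧ Z 1 ∈ S (Z 0))
    {p₀ p₁ : Proj1 K} (h₀ : p₀ ∈ A) (h₁ : p₁ ∈ A) (hcard : (S p₁).card ≤ (S p₀).card) :
    S p₁ ⊆ S p₀ := by
  classical
  intro w hw₁
  by_contra hw₀
  obtain ⟨b, hb⟩ : ∃ b, (S p₀).card = b + 1 :=
    Nat.exists_eq_succ_of_ne_zero (by have := Finset.card_pos.2 ⟨w, hw₁⟩; omega)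
  let B : Finset (Proj1 K) := A.filter fun p => b + 1 < (S p).card
  let F : R2 K := ∏ p ∈ B, lin 0 p
  let φ : Pt2 K → MvPolynomial (Fin 2) K := fun Z =>
    if Z 1 = w then restr Z F * MvPolynomial.X 1 ^ b else 0
  obtain ⟨a₀, a₁, ha⟩ := exists_dual_s18 w
  let z : R2 K := C a₀ * MvPolynomial.X ⟨1, (0 : Fin 2)⟩ + C a₁ * MvPolynomial.X ⟨1, (1 : Fin 2)⟩
  have hz : ∀ Z : Pt2 K, Z 1 = w → restr Z z = MvPolynomial.X 1 := by
    intro Z hZ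
    simp only [z, restr, map_add, map_mul, algHom_C, algebraMap_eq, aeval_X, hZ]
    rw [← mul_assoc, ← mul_assoc, ← C_mul, ← C_mul, ← add_mul, ← C_add, ha, C_1, one_mul]
  obtain ⟨f, hf⟩ : IsPoly X φ := by
    refine isPoly_of_maxIdeal_le_radical hL hreg fun 𝔭 hp h => ?_
    have hE : ∀ p ∈ A, ∏ p' ∈ A.erase p, lin 0 p' ∈ 𝔭 := by
      intro p hpA
      apply h
      have hvan : ∀ Z ∈ X, Z 0 ≠ p → restr Z (∏ p' ∈ A.erase p, lin 0 p') = 0 := fun Z hZ hne =>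
        restr_prod_lin_eq_zero.2 (Finset.mem_erase.2 ⟨hne, ((hX Z).1 hZ).1⟩)
      by_cases hgood : p ∉ B ∧ w ∈ S p
      · obtain ⟨hpB, hwp⟩ := hgood
        have hcp : (S p).card ≤ b + 1 := by
          simpa [B, hpA] using hpB
        have hce := Finset.card_erase_of_mem hwp
        let κ : K := ∏ q ∈ (S p).erase w, cross q w
        have hκ : κ ≠ 0 := Finset.prod_ne_zero_iff.2 fun q hq h0 =>
          Finset.ne_of_mem_erase hq (cross_eq_zero.1 h0)
        refine ⟨(∏ p' ∈ A.erase p, lin 0 p') * (F * (C κ⁻¹ * z ^ (b - ((S p).erase w).card) *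
          ∏ q ∈ (S p).erase w, lin 1 q)), fun Z hZ => ?_⟩
        by_cases hZp : Z 0 = p
        · simp only [φ]
          split_ifs with hZw
          · rw [map_mul, map_mul, map_mul, map_mul, map_pow, hz Z hZw, restr_prod_lin (i := 1),
              hZw, algHom_C, algebraMap_eq]
            have hpow : (MvPolynomial.X 1 : MvPolynomial (Fin 2) K) ^ b =
                MvPolynomial.X 1 ^ (b - ((S p).erase w).card) *
                  MvPolynomial.X 1 ^ ((S p).erase w).card := by
              rw [← pow_add, Nat.sub_add_cancel (by omega)]
            have hκ' : (C κ⁻¹ * C κ : MvPolynomial (Fin 2) K) = 1 := by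
              rw [← C_mul, inv_mul_cancel₀ hκ, C_1]
            rw [hpow]
            linear_combination (restr Z (∏ p' ∈ A.erase p, lin 0 p')) * restr Z F *
              MvPolynomial.X 1 ^ (b - ((S p).erase w).card) *
              MvPolynomial.X 1 ^ ((S p).erase w).card * hκ'
          · have : restr Z (∏ q ∈ (S p).erase w, lin 1 q) = 0 :=
              restr_prod_lin_eq_zero.2 (Finset.mem_erase.2 ⟨hZw, hZp ▸ ((hX Z).1 hZ).2⟩)
            rw [map_mul, map_mul, map_mul, this]
            ring
        · beta_reduce
          rw [map_mul, hvan Z hZ hZp, zero_mul, zero_mul]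
      · refine ⟨0, fun Z hZ => ?_⟩
        by_cases hZp : Z 0 = p
        · simp only [φ]
          split_ifs with hZw
          · have hpB : Z 0 ∈ B := by
              rw [hZp]
              by_contra hpB
              exact hgood ⟨hpB, hZw ▸ hZp ▸ ((hX Z).1 hZ).2⟩
            rw [restr_prod_lin_eq_zero.2 hpB]
            simp
          · simp
        · beta_reduce
          rw [hvan Z hZ hZp, zero_mul, map_zero]
    have hG : ∀ q ∈ A.biUnion S, ∏ q' ∈ (A.biUnion S).erase q, lin 1 q' ∈ 𝔭 := by
      intro q _
      apply h
      have hvan : ∀ Z ∈ X, Z 1 ≠ q → restr Z (∏ q' ∈ (A.biUnion S).erase q, lin 1 q') = 0 :=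
        fun Z hZ hne => restr_prod_lin_eq_zero.2 (Finset.mem_erase.2
          ⟨hne, Finset.mem_biUnion.2 ⟨Z 0, (hX Z).1 hZ⟩⟩)
      by_cases hqw : q = w
      · refine ⟨(∏ q' ∈ (A.biUnion S).erase q, lin 1 q') * (F * z ^ b), fun Z hZ => ?_⟩
        by_cases hZq : Z 1 = q
        · simp only [φ, if_pos (hZq.trans hqw), map_mul, map_pow, hz Z (hZq.trans hqw)]
        · beta_reduce
          rw [map_mul, hvan Z hZ hZq, zero_mul, zero_mul]
      · refine ⟨0, fun Z hZ => ?_⟩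
        by_cases hZq : Z 1 = q
        · simp [φ, hZq, hqw]
        · beta_reduce
          rw [hvan Z hZ hZq, zero_mul, map_zero]
    rintro ⟨i, j⟩
    fin_cases i
    · exact X_mem_of_prod_lin_mem hp ⟨p₀, h₀⟩ hE j
    · exact X_mem_of_prod_lin_mem hp ⟨w, Finset.mem_biUnion.2 ⟨p₁, h₁, hw₁⟩⟩ hG j
  let d : Fin 2 → ℕ := ![B.card, b]
  let pt : Proj1 K → Proj1 K → Pt2 K := fun p q => ![p, q]
  have hpt0 : ∀ p q q', Function.update (pt p q) 1 q' = pt p q' := by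
    intro p q q'; ext l; fin_cases l <;> simp [pt]
  have hpt1 : ∀ p q p', Function.update (pt p q) 0 p' = pt p' q := by
    intro p q q'; ext l; fin_cases l <;> simp [pt]
  have hp₀B : p₀ ∉ B := by simp [B, hb]
  have hp₁B : p₁ ∉ B := by simp [B, h₁]; omega
  have hzero : ∀ p ∈ insert p₀ B,
      coeff (Finsupp.equivFunOnFinite.symm d) (restr (pt p w) f) = 0 := by
    intro p hpB
    have hpA : p ∈ A := by
      rcases Finset.mem_insert.1 hpB with rfl | h
      exacts [h₀, (Finset.mem_filter.1 h).1]
    refine coeff_restr_eq_zero (i := 1) (j := 0) (by decide) _ _ (S p) (fun q hq => ?_) ?_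
    · rw [hpt0, hf _ ((hX _).2 ⟨hpA, hq⟩)]
      simp only [φ]
      split_ifs with hqw
      · rcases Finset.mem_insert.1 hpB with rfl | h
        · exact absurd (show w ∈ S p from hqw ▸ hq) hw₀
        · rw [restr_prod_lin_eq_zero.2 (show pt p q 0 ∈ B from h), zero_mul]
      · rfl
    · change b < _
      rcases Finset.mem_insert.1 hpB with rfl | h
      · omega
      · have := (Finset.mem_filter.1 h).2
        omega
  have hone : coeff (Finsupp.equivFunOnFinite.symm d) (restr (pt p₁ w) f) = 0 := by
    have := coeff_restr_eq_zero (i := 0) (j := 1) (by decide) (pt p₁ w)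
      (weightedHomogeneousComponent (wt 2 (fun _ => 1)) d f) (insert p₀ B) (fun p hp => by
        rw [hpt1, restr_weightedHomogeneousComponent, hzero p hp, map_zero])
      (d := Finsupp.equivFunOnFinite.symm d) (by
        rw [Finset.card_insert_of_notMem hp₀B]
        exact Nat.lt_succ_self _)
    simpa [restr_weightedHomogeneousComponent] using this
  rw [hf _ ((hX _).2 ⟨h₁, hw₁⟩)] at hone
  simp only [φ] at hone
  rw [if_pos (show pt p₁ w 1 = w from rfl), restr_prod_lin, mul_assoc, coeff_C_mul, X_pow_eq_monomial, X_pow_eq_monomial,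
    monomial_mul, coeff_monomial, if_pos, one_mul, mul_one] at hone
  · refine Finset.prod_ne_zero_iff.2 (fun p hp h0 => hp₁B ?_) hone
    have hpp : p = p₁ := cross_eq_zero.1 h0
    exact hpp ▸ hp
  · ext l
    fin_cases l <;> simp [d]

/-! ### Bidiagonal matrices and their maximal minors -/

section Bidiagonal

variable {R : Type*} [CommRing R]

/-- The matrix with diagonal entries `a l` and superdiagonal entries `- b l`. -/
def bidiag (a b : ℕ → R) (l k : ℕ) : R := if k = l then a l else if k = l + 1 then - b l else 0

/-- The `k`-th maximal minor of the `r × (r + 1)` matrix `bidiag a b`. -/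
def bidiagMinor (a b : ℕ → R) (r k : ℕ) : R := (∏ l ∈ Finset.range k, a l) * ∏ l ∈ Finset.Ico k r, b l

lemma sum_bidiag_mul_bidiagMinor (a b : ℕ → R) {r l : ℕ} (hl : l < r) :
    ∑ k ∈ Finset.range (r + 1), bidiag a b l k * bidiagMinor a b r k = 0 := by
  have hsub : ({l, l + 1} : Finset ℕ) ⊆ Finset.range (r + 1) := by
    intro k hk
    simp only [Finset.mem_insert, Finset.mem_singleton] at hk
    simp only [Finset.mem_range]
    omega
  rw [← Finset.sum_subset hsub, Finset.sum_pair (by simp)]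
  · simp only [bidiag, bidiagMinor, if_true, Nat.succ_ne_self, if_false, Finset.prod_range_succ]
    rw [Finset.prod_eq_prod_Ico_succ_bot hl]
    ring
  · intro k _ hk
    simp only [Finset.mem_insert, Finset.mem_singleton, not_or] at hk
    simp [bidiag, hk]

lemma exists_eq_sum_bidiag [IsDomain R] (a b : ℕ → R) (r : ℕ) (hb : ∀ k < r, b k ≠ 0)
    (hab : ∀ k < r, ∀ z, b k ∣ z * ∏ l ∈ Finset.range (k + 1), a l → b k ∣ z)
    (x : ℕ → R) (hx : ∑ k ∈ Finset.range (r + 1), x k * bidiagMinor a b r k = 0) :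
    ∃ y : ℕ → R, ∀ k < r + 1, x k = ∑ l ∈ Finset.range r, y l * bidiag a b l k := by
  induction r generalizing x with
  | zero =>
    refine ⟨0, fun k hk => ?_⟩
    obtain rfl : k = 0 := by omega
    simpa [bidiagMinor] using hx
  | succ r ih =>
    have hminor : ∀ k ≤ r, bidiagMinor a b (r + 1) k = bidiagMinor a b r k * b r := by
      intro k hk
      rw [bidiagMinor, bidiagMinor, Finset.prod_Ico_succ_top hk, mul_assoc]
    have hlast : bidiagMinor a b (r + 1) (r + 1) = ∏ l ∈ Finset.range (r + 1), a l := by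
      simp [bidiagMinor]
    have hdiag : bidiagMinor a b r r = ∏ l ∈ Finset.range r, a l := by
      simp [bidiagMinor]
    rw [Finset.sum_range_succ, hlast] at hx
    have hsum : ∑ k ∈ Finset.range (r + 1), x k * bidiagMinor a b (r + 1) k =
        (∑ k ∈ Finset.range (r + 1), x k * bidiagMinor a b r k) * b r := by
      rw [Finset.sum_mul]
      refine Finset.sum_congr rfl fun k hk => ?_
      rw [hminor k (by simpa [Nat.lt_succ_iff] using hk), mul_assoc]
    rw [hsum] at hx
    obtain ⟨w, hw⟩ := hab r (Nat.lt_succ_self r) (x (r + 1))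
      ⟨-∑ k ∈ Finset.range (r + 1), x k * bidiagMinor a b r k, by linear_combination hx⟩
    have hbr := hb r (Nat.lt_succ_self r)
    obtain ⟨y, hy⟩ := ih (fun k hk => hb k (by omega)) (fun k hk => hab k (by omega))
      (fun k => if k = r then x r + w * a r else x k) (by
        apply mul_right_cancel₀ hbr
        rw [zero_mul, ← hx, Finset.sum_range_succ, Finset.sum_range_succ (n := r), if_pos rfl,
          hdiag, hw, Finset.prod_range_succ,
          Finset.sum_congr rfl fun k hk => by rw [if_neg (Finset.mem_range.1 hk).ne]]
        ring)
    refine ⟨fun l => if l = r then -w else y l, fun k hk => ?_⟩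
    rw [Finset.sum_range_succ]
    beta_reduce
    rw [if_pos rfl, Finset.sum_congr rfl fun l hl => by rw [if_neg (Finset.mem_range.1 hl).ne]]
    rcases Nat.lt_succ_iff_lt_or_eq.1 hk with hk | rfl
    · rw [← hy k hk]
      by_cases hkr : k = r
      · simp [hkr, bidiag]
      · have : k ≠ r + 1 := by omega
        simp [hkr, bidiag, this]
    · rw [Finset.sum_eq_zero fun l hl => ?_]
      · simp [bidiag, hw, mul_comm]
      · have := Finset.mem_range.1 hl
        rw [bidiag, if_neg (by omega), if_neg (by omega), mul_zero]

lemma eq_zero_of_sum_bidiag_eq_zero [IsDomain R] (a b : ℕ → R) (r : ℕ) (ha : ∀ k < r, a k ≠ 0)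
    (y : ℕ → R) (hy : ∀ k < r + 1, ∑ l ∈ Finset.range r, y l * bidiag a b l k = 0) :
    ∀ l < r, y l = 0 := by
  intro l
  induction l using Nat.strong_induction_on with
  | _ l ih =>
    intro hl
    have h := hy l (by omega)
    rw [Finset.sum_eq_single l] at h
    · simpa [bidiag, ha l hl] using h
    · intro m hm hml
      rcases lt_or_gt_of_ne hml with hlt | hlt
      · rw [ih m hlt (by omega), zero_mul]
      · rw [bidiag, if_neg (by omega), if_neg (by omega), mul_zero]
    · simp [hl]

end Bidiagonal

/-! ### Staircases -/

/-- Enumeration of the positions where a non-increasing sequence drops. -/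
lemma exists_steps {α : ℕ → ℕ} (hα : Antitone α) (n : ℕ) :
    ∃ (r : ℕ) (e : ℕ → ℕ), e 0 = 0 ∧ e r ≤ n ∧ (∀ k < r, e k < e (k + 1)) ∧
      (∀ i ≤ n, (i = 0 ∨ α i < α (i - 1)) ↔ ∃ k ≤ r, e k = i) ∧
      (∀ k < r, α (e (k + 1) - 1) = α (e k)) ∧ α n = α (e r) := by
  induction n with
  | zero =>
    refine ⟨0, fun _ => 0, rfl, le_rfl, by simp, fun i hi => ?_, by simp, rfl⟩
    obtain rfl : i = 0 := by omega
    simp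
  | succ n ih =>
    obtain ⟨r, e, h0, hr, hlt, hmem, hconst, hn⟩ := ih
    by_cases hstep : α (n + 1) < α n
    · refine ⟨r + 1, fun k => if k = r + 1 then n + 1 else e k, by simp [h0], by simp, ?_, ?_, ?_,
        by simp⟩
      · intro k hk
        dsimp only
        rw [if_neg (by omega)]
        split_ifs with h
        · obtain rfl : k = r := by omega
          omega
        · exact hlt k (by omega)
      · intro i hi
        rcases Nat.le_succ_iff.1 hi with hi | rfl
        · rw [hmem i hi]
          constructor
          · rintro ⟨k, hk, hki⟩
            exact ⟨k, by omega, by dsimp only; rw [if_neg (by omega), hki]⟩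
          · rintro ⟨k, hk, hki⟩
            dsimp only at hki
            split_ifs at hki with h
            · omega
            · exact ⟨k, by omega, hki⟩
        · exact ⟨fun _ => ⟨r + 1, le_rfl, if_pos rfl⟩, fun _ => Or.inr hstep⟩
      · intro k hk
        dsimp only
        rw [if_neg (show k ≠ r + 1 by omega)]
        split_ifs with h
        · obtain rfl : k = r := by omega
          simpa using hn
        · exact hconst k (by omega)
    · have heq : α (n + 1) = α n := le_antisymm (hα n.le_succ) (not_lt.1 hstep)
      refine ⟨r, e, h0, by omega, hlt, fun i hi => ?_, hconst, heq.trans hn⟩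
      rcases Nat.le_succ_iff.1 hi with hi | rfl
      · exact hmem i hi
      · constructor
        · rintro (h | h)
          · omega
          · exact absurd h hstep
        · rintro ⟨k, hk, hki⟩
          have : ∀ m, k + m ≤ r → e k ≤ e (k + m) := by
            intro m
            induction m with
            | zero => exact fun _ => le_rfl
            | succ m ihm => exact fun h => (ihm (by omega)).trans (hlt (k + m) (by omega)).le
          have := this (r - k) (by omega)
          rw [Nat.add_sub_cancel' hk] at this
          omega

/-! ### Products of linear forms -/

lemma lin_ne_zero (i : Fin 2) (p : Proj1 K) : lin i p ≠ 0 := by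
  obtain ⟨a, b, hab⟩ := exists_dual_s18 p
  intro h
  have h1 := congrArg (eval fun x => if x.2 = 0 then b else -a) h
  simp [lin] at h1
  exact one_ne_zero (α := K) (by linear_combination h1 - hab)

lemma isWeightedHomogeneous_lin (i : Fin 2) (p : Proj1 K) :
    IsWeightedHomogeneous (wt 2 (fun _ => 1)) (lin i p) (Pi.single i 1) :=
  ((isWeightedHomogeneous_X K (wt 2 (fun _ => 1)) ⟨i, (0 : Fin 2)⟩).C_mul _).sub
    ((isWeightedHomogeneous_X K (wt 2 (fun _ => 1)) ⟨i, (1 : Fin 2)⟩).C_mul _)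

lemma isWeightedHomogeneous_prod_lin {ι : Type*} (i : Fin 2) (s : Finset ι) (p : ι → Proj1 K) :
    IsWeightedHomogeneous (wt 2 (fun _ => 1)) (∏ l ∈ s, lin i (p l)) (Pi.single i s.card) := by
  have := IsWeightedHomogeneous.prod s (fun l => lin i (p l)) _
    fun l _ => isWeightedHomogeneous_lin i (p l)
  convert this using 1
  rw [Finset.sum_const, ← Pi.single_smul]
  simp

lemma lin_mem_maxIdeal (i : Fin 2) (p : Proj1 K) : lin i p ∈ maxIdeal K 2 (fun _ => 1) :=
  sub_mem (Ideal.mul_mem_left _ _ (Ideal.subset_span ⟨_, rfl⟩))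
    (Ideal.mul_mem_left _ _ (Ideal.subset_span ⟨_, rfl⟩))

lemma prod_lin_mem_maxIdeal {ι : Type*} (i : Fin 2) {s : Finset ι} (hs : s.Nonempty)
    (p : ι → Proj1 K) : ∏ l ∈ s, lin i (p l) ∈ maxIdeal K 2 (fun _ => 1) := by
  obtain ⟨l, hl⟩ := hs
  exact Ideal.mem_of_dvd _ (Finset.dvd_prod_of_mem _ hl) (lin_mem_maxIdeal i (p l))

lemma irreducible_lin (i : Fin 2) (p : Proj1 K) : Irreducible (lin i p) := by
  have hhom : (lin i p).IsHomogeneous 1 :=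
    ((isHomogeneous_C_mul_X _ _).sub (isHomogeneous_C_mul_X _ _))
  refine irreducible_of_totalDegree_eq_one (hhom.totalDegree (lin_ne_zero i p)) fun x hx => ?_
  rw [isUnit_iff_ne_zero]
  rintro rfl
  refine lin_ne_zero i p (MvPolynomial.ext _ _ fun m => ?_)
  rw [zero_dvd_iff.1 (hx m), coeff_zero]

lemma isRelPrime_lin {i j : Fin 2} (hij : i ≠ j) (p q : Proj1 K) :
    IsRelPrime (lin i p) (lin j q) := by
  rw [(irreducible_lin i p).isRelPrime_iff_not_dvd]
  rintro ⟨g, hg⟩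
  have h := congrArg (aeval fun x : Sig 2 (fun _ => 1) => if x.1 = j then X x else (0 : R2 K)) hg
  rw [map_mul] at h
  simp [lin, hij] at h
  exact lin_ne_zero j q h

/-- The ideal of a staircase of points is generated by its corner products. -/
lemma prod_lin_mul_mem {A : ℕ → Proj1 K} {S : ℕ → Finset (Proj1 K)} {t : ℕ}
    (hA : ∀ i < t, ∀ j < t, A i = A j → i = j) (hS : Antitone S) (ht : S t = ∅)
    {J : Ideal (R2 K)}
    (hJ : ∀ i ≤ t, (∏ l ∈ Finset.range i, lin 0 (A l)) * ∏ q ∈ S i, lin 1 q ∈ J)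
    {i : ℕ} (hi : i ≤ t) {f : R2 K}
    (hf : ∀ k < t, i ≤ k → ∀ q ∈ S k, restr ![A k, q] f = 0) :
    (∏ l ∈ Finset.range i, lin 0 (A l)) * f ∈ J := by
  obtain ⟨n, rfl⟩ := Nat.exists_eq_add_of_le hi
  induction n generalizing i f with
  | zero =>
    have := J.mul_mem_right f (hJ i le_rfl)
    have h0 : S i = ∅ := ht
    simpa [h0] using this
  | succ n ih =>
    obtain ⟨g, h, rfl⟩ := exists_eq_lin_mul_add_prod_mul (i := 1) (j := 0) (by decide)
      (![A i, A i] : Pt2 K) f (S i) (fun q hq => by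
        have := hf i (by omega) le_rfl q hq
        have hupd : Function.update (![A i, A i] : Pt2 K) 1 q = ![A i, q] := by
          funext l; fin_cases l <;> simp
        rw [hupd]
        exact this)
    have hg : (∏ l ∈ Finset.range (i + 1), lin 0 (A l)) * g ∈ J := by
      have hn : i + (n + 1) = i + 1 + n := by ring
      rw [hn] at hA ht hJ hf
      refine ih hA ht hJ (by omega) fun k hk hik q hq => ?_
      have h0 := hf k hk (by omega) q hq
      have hq' : restr ![A k, q] (∏ q ∈ S i, lin 1 q) = 0 :=
        restr_prod_lin_eq_zero.2 (hS (by omega : i ≤ k) hq)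
      rw [map_add, map_mul, map_mul, hq', zero_mul, add_zero, mul_eq_zero, restr_lin_eq_zero] at h0
      refine h0.resolve_left fun h => ?_
      have := hA i (by omega) k hk h
      omega
    have hh := J.mul_mem_right h (hJ i hi)
    rw [Finset.prod_range_succ] at hg
    convert add_mem hg hh using 1
    simp only [Matrix.cons_val_zero]
    ring

/-! ### The resolution of a staircase of points -/

/-- The corner generators of the ideal of the staircase given by `A` and `S`. -/
def cornerGen (A : ℕ → Proj1 K) (S : ℕ → Finset (Proj1 K)) (i : ℕ) : R2 K :=
  (∏ l ∈ Finset.range i, lin 0 (A l)) * ∏ q ∈ S i, lin 1 q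

open Classical in
/-- The syzygy between consecutive corners of the staircase given by `A` and `S`. -/
def cornerSyz (A : ℕ → Proj1 K) (S : ℕ → Finset (Proj1 K)) (v c : ℕ × ℕ) : R2 K :=
  if c.1 = v.1 then -∏ q ∈ S (v.1 - 1) \ S v.1, lin 1 q
  else if c.2 = v.2 then ∏ l ∈ Finset.Ico c.1 v.1, lin 0 (A l) else 0

lemma single_add_single (m n : ℕ) :
    (Pi.single 0 m + Pi.single 1 n : Fin 2 → ℕ) = ![m, n] := by
  funext i
  fin_cases i <;> simp

lemma isWeightedHomogeneous_cornerGen (A : ℕ → Proj1 K) (S : ℕ → Finset (Proj1 K)) (i : ℕ) :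
    IsWeightedHomogeneous (wt 2 (fun _ => 1)) (cornerGen A S i) ![i, (S i).card] := by
  have := (isWeightedHomogeneous_prod_lin 0 (Finset.range i) A).mul
    (isWeightedHomogeneous_prod_lin 1 (S i) id)
  rwa [Finset.card_range, single_add_single] at this

/-- Enumeration of the strict inclusions of a decreasing sequence of finite sets ending with the
empty set. -/
lemma exists_drops {ι : Type*} {S : ℕ → Finset ι} {t : ℕ} (hS : Antitone S) (ht0 : 0 < t)
    (hne : ∀ i < t, (S i).Nonempty) (ht : S t = ∅) :
    ∃ (r : ℕ) (e : ℕ → ℕ), e 0 = 0 ∧ e r = t ∧ (∀ k l, k < l → l ≤ r → e k < e l) ∧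
      (∀ k l, k < l → l ≤ r → (S (e l)).card < (S (e k)).card) ∧
      (∀ i ≤ t, (i = 0 ∨ (S i).card < (S (i - 1)).card) ↔ ∃ k ≤ r, e k = i) ∧
      (∀ k < r, S (e (k + 1) - 1) = S (e k)) := by
  obtain ⟨r, e, h0, her, hlt, hmem, hconst, -⟩ :=
    exists_steps (α := fun i => (S i).card) (fun i j h => Finset.card_le_card (hS h)) t
  have hmono : ∀ k l, k < l → l ≤ r → e k < e l := by
    intro k l hkl
    induction l, hkl using Nat.le_induction with
    | base => exact fun h => hlt k h
    | succ l _ ih => exact fun h => (ih (by omega)).trans (hlt l h)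
  have hlast : e r = t := by
    obtain ⟨k, hk, hkt⟩ := (hmem t le_rfl).1
      (Or.inr (by simpa [ht] using (hne (t - 1) (by omega)).card_pos))
    rcases hk.lt_or_eq with hk | rfl
    · have := hmono k r hk le_rfl
      omega
    · exact hkt
  have hle : ∀ k ≤ r, e k ≤ t := fun k hk => by
    rcases hk.lt_or_eq with hk | rfl
    · have := hmono k r hk le_rfl
      omega
    · exact her
  refine ⟨r, e, h0, hlast, hmono, ?_, hmem, ?_⟩
  · intro k l hkl
    have hstep : ∀ k < r, (S (e (k + 1))).card < (S (e k)).card := by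
      intro k hk
      have h1 := hlt k hk
      have h2 := ((hmem _ (hle (k + 1) hk)).2 ⟨k + 1, hk, rfl⟩).resolve_left (by omega)
      exact h2.trans_eq (hconst k hk)
    induction l, hkl using Nat.le_induction with
    | base => exact fun h => hstep k h
    | succ l _ ih => exact fun h => (hstep l h).trans (ih (by omega))
  · intro k hk
    have h1 := hlt k hk
    exact Finset.eq_of_subset_of_card_le (hS (by omega)) (hconst k hk).ge

lemma idealOfSet_eq_span_cornerGen [Infinite K] {A : ℕ → Proj1 K} {S : ℕ → Finset (Proj1 K)}
    {t : ℕ} (hA : ∀ i < t, ∀ j < t, A i = A j → i = j) (hS : Antitone S) (ht : S t = ∅)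
    {X : Set (Pt2 K)} (hX : ∀ Z, Z ∈ X ↔ ∃ k < t, ∃ q ∈ S k, Z = ![A k, q])
    {E : Set ℕ} (hstep : ∀ i ≤ t, i = 0 ∨ (S i).card < (S (i - 1)).card → i ∈ E) :
    idealOfSet K 2 (fun _ => 1) X = Ideal.span (cornerGen A S '' E) := by
  apply le_antisymm
  · intro f hf
    rw [mem_idealOfSet_s18] at hf
    have hJ : ∀ i ≤ t, cornerGen A S i ∈ Ideal.span (cornerGen A S '' E) := by
      intro i
      induction i with
      | zero => exact fun h => Ideal.subset_span ⟨0, hstep 0 h (Or.inl rfl), rfl⟩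
      | succ i ih =>
        intro h
        by_cases hi : (S (i + 1)).card < (S i).card
        · exact Ideal.subset_span ⟨i + 1, hstep _ h (Or.inr hi), rfl⟩
        · have hSi : S (i + 1) = S i :=
            Finset.eq_of_subset_of_card_le (hS i.le_succ) (not_lt.1 hi)
          have := Ideal.mul_mem_left _ (lin 0 (A i)) (ih (by omega))
          convert this using 1
          rw [cornerGen, cornerGen, hSi, Finset.prod_range_succ]
          ring
    simpa using prod_lin_mul_mem hA hS ht hJ (Nat.zero_le t) (f := f)
      fun k hk _ q hq => hf _ ((hX _).2 ⟨k, hk, q, hq, rfl⟩)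
  · rw [Ideal.span_le]
    rintro _ ⟨i, hi, rfl⟩
    rw [SetLike.mem_coe, mem_idealOfSet_s18]
    intro Z hZ
    obtain ⟨k, hk, q, hq, rfl⟩ := (hX Z).1 hZ
    rw [cornerGen, map_mul, mul_eq_zero]
    by_cases hki : k < i
    · left
      rw [map_prod, Finset.prod_eq_zero (Finset.mem_range.2 hki)]
      exact restr_lin_eq_zero.2 rfl
    · right
      exact restr_prod_lin_eq_zero.2 (hS (not_lt.1 hki) hq)

lemma prod_range_prod_Ico {M : Type*} [CommMonoid M] (f : ℕ → M) {e : ℕ → ℕ} (h0 : e 0 = 0)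
    {k : ℕ} (he : ∀ l < k, e l ≤ e (l + 1)) :
    ∏ l ∈ Finset.range k, ∏ i ∈ Finset.Ico (e l) (e (l + 1)), f i =
      ∏ i ∈ Finset.range (e k), f i := by
  induction k with
  | zero => simp [h0]
  | succ k ih =>
    rw [Finset.prod_range_succ, ih fun l hl => he l (by omega),
      Finset.prod_range_mul_prod_Ico _ (he k (by omega))]

lemma cornerGen_eq_bidiagMinor {A : ℕ → Proj1 K} {S : ℕ → Finset (Proj1 K)} {r : ℕ} {e : ℕ → ℕ}
    (hS : Antitone S) (h0 : e 0 = 0) (he : ∀ k l, k < l → l ≤ r → e k < e l)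
    (hr : S (e r) = ∅) [DecidableEq (Proj1 K)] {k : ℕ} (hk : k ≤ r) :
    cornerGen A S (e k) = bidiagMinor (fun l => ∏ i ∈ Finset.Ico (e l) (e (l + 1)), lin 0 (A i))
      (fun l => ∏ q ∈ S (e l) \ S (e (l + 1)), lin 1 q) r k := by
  rw [cornerGen, bidiagMinor]
  congr 1
  · exact (prod_range_prod_Ico _ h0 fun l hl => (he l (l + 1) (by omega) (by omega)).le).symm
  · obtain ⟨n, rfl⟩ := Nat.exists_eq_add_of_le hk
    induction n generalizing k with
    | zero =>
      have hr' : S (e k) = ∅ := hr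
      simp [hr']
    | succ n ih =>
      rw [Finset.prod_eq_prod_Ico_succ_bot (by omega)]
      have hn : k + (n + 1) = k + 1 + n := by ring
      rw [hn] at he hr ⊢
      rw [← ih he hr (by omega),
        Finset.prod_sdiff (hS (he k (k + 1) (by omega) (by omega)).le)]

open Classical in
lemma cornerSyz_eq_bidiag {A : ℕ → Proj1 K} {S : ℕ → Finset (Proj1 K)} {r : ℕ} {e : ℕ → ℕ}
    (he : ∀ k l, k < l → l ≤ r → e k < e l)
    (hcard : ∀ k l, k < l → l ≤ r → (S (e l)).card < (S (e k)).card)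
    (hpred : ∀ k < r, S (e (k + 1) - 1) = S (e k)) {l k : ℕ} (hl : l < r) (hk : k ≤ r) :
    cornerSyz A S (e (l + 1), (S (e l)).card) (e k, (S (e k)).card) =
      bidiag (fun l => ∏ i ∈ Finset.Ico (e l) (e (l + 1)), lin 0 (A i))
        (fun l => ∏ q ∈ S (e l) \ S (e (l + 1)), lin 1 q) l k := by
  simp only [cornerSyz, bidiag]
  rcases lt_trichotomy k (l + 1) with h | rfl | h
  · have h1 := he k (l + 1) h hl
    rw [if_neg h1.ne]
    rcases (Nat.lt_succ_iff.1 h).lt_or_eq with h | rfl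
    · rw [if_neg (hcard k l h hl.le).ne', if_neg h.ne, if_neg (by omega)]
    · simp
  · simp [hpred l hl]
  · rw [if_neg (he _ _ h hk).ne', if_neg (hcard l k (by omega) hk).ne, if_neg (by omega),
      if_neg (by omega)]

lemma dvd_of_dvd_mul_prod_lin {ι : Type*} (s : Finset ι) (p : ι → Proj1 K)
    (u : Finset (Proj1 K)) (z : R2 K)
    (h : ∏ q ∈ u, lin 1 q ∣ z * ∏ i ∈ s, lin 0 (p i)) : ∏ q ∈ u, lin 1 q ∣ z :=
  IsRelPrime.dvd_of_dvd_mul_right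
    (IsRelPrime.prod_left fun q _ => IsRelPrime.prod_right fun i _ =>
      isRelPrime_lin (by decide) q (p i)) h

/-- The minimal graded free resolution of a staircase of points. -/
lemma exists_resolution_of_staircase [Infinite K] {A : ℕ → Proj1 K} {S : ℕ → Finset (Proj1 K)}
    {t : ℕ} (hA : ∀ i < t, ∀ j < t, A i = A j → i = j) (hS : Antitone S) (ht0 : 0 < t)
    (hne : ∀ i < t, (S i).Nonempty) (ht : S t = ∅)
    {X : Set (Pt2 K)} (hX : ∀ Z, Z ∈ X ↔ ∃ k < t, ∃ q ∈ S k, Z = ![A k, q])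
    {C V : Finset (ℕ × ℕ)}
    (hC : ∀ c, c ∈ C ↔
      c.1 ≤ t ∧ (c.1 = 0 ∨ (S c.1).card < (S (c.1 - 1)).card) ∧ c.2 = (S c.1).card)
    (hV : ∀ v, v ∈ V ↔
      v.1 ≤ t ∧ (0 < v.1 ∧ (S v.1).card < (S (v.1 - 1)).card) ∧ v.2 = (S (v.1 - 1)).card) :
    ∃ (Gg : ℕ × ℕ → R2 K) (S : ℕ × ℕ → ℕ × ℕ → R2 K),
      (∀ c ∈ C, IsWeightedHomogeneous (wt 2 (fun _ => 1)) (Gg c) ![c.1, c.2]) ∧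
      idealOfSet K 2 (fun _ => 1) X = Ideal.span (Gg '' (C : Set (ℕ × ℕ))) ∧
      (∀ v ∈ V, ∀ c ∈ C, S v c = 0 ∨ (c.1 ≤ v.1 ∧ c.2 ≤ v.2 ∧
        IsWeightedHomogeneous (wt 2 (fun _ => 1)) (S v c) ![v.1 - c.1, v.2 - c.2])) ∧
      (∀ v ∈ V, ∀ c ∈ C, S v c ∈ maxIdeal K 2 (fun _ => 1)) ∧
      (∀ v ∈ V, ∑ c ∈ C, S v c * Gg c = 0) ∧
      (∀ a : ℕ × ℕ → R2 K, ∑ c ∈ C, a c * Gg c = 0 →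
        ∃ b : ℕ × ℕ → R2 K, ∀ c ∈ C, a c = ∑ v ∈ V, b v * S v c) ∧
      (∀ b : ℕ × ℕ → R2 K, (∀ c ∈ C, ∑ v ∈ V, b v * S v c = 0) → ∀ v ∈ V, b v = 0) := by
  classical
  obtain ⟨r, e, h0, hr, he, hcard, hmem, hpred⟩ := exists_drops hS ht0 hne ht
  have hle : ∀ k ≤ r, e k ≤ t := fun k hk => by
    rcases hk.lt_or_eq with hk | rfl
    · exact hr ▸ (he k r hk le_rfl).le
    · exact hr.le
  have hinj : ∀ k ≤ r, ∀ l ≤ r, e k = e l → k = l := by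
    intro k hk l hl h
    rcases lt_trichotomy k l with hkl | hkl | hkl
    · exact absurd h (he k l hkl hl).ne
    · exact hkl
    · exact absurd h (he l k hkl hk).ne'
  set cc : ℕ → ℕ × ℕ := fun k => (e k, (S (e k)).card) with hcc
  set vv : ℕ → ℕ × ℕ := fun l => (e (l + 1), (S (e l)).card) with hvv
  set a : ℕ → R2 K := fun l => ∏ i ∈ Finset.Ico (e l) (e (l + 1)), lin 0 (A i) with ha
  set b : ℕ → R2 K := fun l => ∏ q ∈ S (e l) \ S (e (l + 1)), lin 1 q with hb
  have hCi : C = (Finset.range (r + 1)).image cc := by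
    ext ⟨i, m⟩
    simp only [hC, Finset.mem_image, Finset.mem_range, hcc, Prod.mk.injEq, Nat.lt_succ_iff]
    constructor
    · rintro ⟨hi, hs, rfl⟩
      obtain ⟨k, hk, rfl⟩ := (hmem i hi).1 hs
      exact ⟨k, hk, rfl, rfl⟩
    · rintro ⟨k, hk, rfl, rfl⟩
      exact ⟨hle k hk, (hmem _ (hle k hk)).2 ⟨k, hk, rfl⟩, rfl⟩
  have hVi : V = (Finset.range r).image vv := by
    ext ⟨i, m⟩
    simp only [hV, Finset.mem_image, Finset.mem_range, hvv, Prod.mk.injEq]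
    constructor
    · rintro ⟨hi, ⟨hpos, hs⟩, rfl⟩
      obtain ⟨k, hk, rfl⟩ := (hmem i hi).1 (Or.inr hs)
      obtain ⟨l, rfl⟩ := Nat.exists_eq_succ_of_ne_zero (n := k) (by rintro rfl; omega)
      exact ⟨l, hk, rfl, by rw [Nat.succ_eq_add_one, hpred l hk]⟩
    · rintro ⟨l, hl, rfl, rfl⟩
      have h1 := he l (l + 1) (by omega) hl
      exact ⟨hle _ hl, ⟨by omega, by rw [hpred l hl]; exact hcard l (l + 1) (by omega) hl⟩,
        by rw [hpred l hl]⟩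
  have hsumC : ∀ f : ℕ × ℕ → R2 K, ∑ c ∈ C, f c = ∑ k ∈ Finset.range (r + 1), f (cc k) := by
    intro f
    rw [hCi, Finset.sum_image]
    intro k hk l hl h
    simp only [Finset.coe_range, Set.mem_Iio, Nat.lt_succ_iff] at hk hl
    exact hinj k hk l hl (Prod.mk.inj h).1
  have hvinj : ∀ k < r, ∀ l < r, vv k = vv l → k = l := by
    intro k hk l hl h
    exact Nat.succ_injective (hinj _ hk _ hl (Prod.mk.inj h).1)
  have hsumV : ∀ f : ℕ × ℕ → R2 K, ∑ v ∈ V, f v = ∑ l ∈ Finset.range r, f (vv l) := by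
    intro f
    rw [hVi, Finset.sum_image]
    intro k hk l hl h
    simp only [Finset.coe_range, Set.mem_Iio] at hk hl
    exact hvinj k hk l hl h
  have hgen : ∀ k ≤ r, cornerGen A S (cc k).1 = bidiagMinor a b r k := fun k hk =>
    cornerGen_eq_bidiagMinor hS h0 he (hr ▸ ht) hk
  have hsyz : ∀ l < r, ∀ k ≤ r, cornerSyz A S (vv l) (cc k) = bidiag a b l k := fun l hl k hk =>
    cornerSyz_eq_bidiag he hcard hpred hl hk
  have hCmem : ∀ c ∈ C, ∃ k ≤ r, c = cc k := by
    intro c hc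
    simp only [hCi, Finset.mem_image, Finset.mem_range, Nat.lt_succ_iff] at hc
    obtain ⟨k, hk, rfl⟩ := hc
    exact ⟨k, hk, rfl⟩
  have hVmem : ∀ v ∈ V, ∃ l < r, v = vv l := by
    intro v hv
    simp only [hVi, Finset.mem_image, Finset.mem_range] at hv
    obtain ⟨k, hk, rfl⟩ := hv
    exact ⟨k, hk, rfl⟩
  have hcomb : ∀ y : ℕ × ℕ → R2 K, ∀ k ≤ r, ∑ v ∈ V, y v * cornerSyz A S v (cc k) =
      ∑ l ∈ Finset.range r, y (vv l) * bidiag a b l k := by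
    intro y k hk
    rw [hsumV]
    exact Finset.sum_congr rfl fun l hl => by rw [hsyz l (Finset.mem_range.1 hl) k hk]
  have hsdiff : ∀ l < r, (S (e l) \ S (e (l + 1))).card = (S (e l)).card - (S (e (l + 1))).card :=
    fun l hl => Finset.card_sdiff_of_subset (hS (he l (l + 1) (by omega) hl).le)
  refine ⟨fun c => cornerGen A S c.1, cornerSyz A S, ?_, ?_, ?_, ?_, ?_, ?_, ?_⟩
  · intro c hc
    obtain ⟨k, -, rfl⟩ := hCmem c hc
    exact isWeightedHomogeneous_cornerGen A S (e k)
  · rw [← Set.image_image (cornerGen A S) Prod.fst]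
    exact idealOfSet_eq_span_cornerGen hA hS ht hX fun i hi hs =>
      ⟨(i, (S i).card), (hC _).2 ⟨hi, hs, rfl⟩, rfl⟩
  · intro v hv c hc
    obtain ⟨l, hl, rfl⟩ := hVmem v hv
    obtain ⟨k, hk, rfl⟩ := hCmem c hc
    rw [hsyz l hl k hk, bidiag]
    have h1 := he l (l + 1) (by omega) hl
    have h2 := hcard l (l + 1) (by omega) hl
    split_ifs with h h
    · subst h
      refine Or.inr ⟨h1.le, le_rfl, ?_⟩
      have := isWeightedHomogeneous_prod_lin 0 (Finset.Ico (e k) (e (k + 1))) A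
      rw [← add_zero (Pi.single _ _), ← Pi.single_zero 1, single_add_single, Nat.card_Ico] at this
      simpa [hcc, hvv] using this
    · subst h
      refine Or.inr ⟨le_rfl, h2.le, ?_⟩
      have := (isWeightedHomogeneous_prod_lin 1 (S (e l) \ S (e (l + 1))) id).neg
      rw [← zero_add (Pi.single _ _), ← Pi.single_zero 0, single_add_single, hsdiff l hl] at this
      simpa [hcc, hvv] using this
    · exact Or.inl rfl
  · intro v hv c hc
    obtain ⟨l, hl, rfl⟩ := hVmem v hv
    obtain ⟨k, hk, rfl⟩ := hCmem c hc
    rw [hsyz l hl k hk, bidiag]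
    split_ifs
    · exact prod_lin_mem_maxIdeal 0 (Finset.nonempty_Ico.2 (he l (l + 1) (by omega) hl)) A
    · refine neg_mem (prod_lin_mem_maxIdeal 1 (Finset.card_pos.1 ?_) id)
      rw [hsdiff l hl]
      exact Nat.sub_pos_of_lt (hcard l (l + 1) (by omega) hl)
    · exact zero_mem _
  · intro v hv
    obtain ⟨l, hl, rfl⟩ := hVmem v hv
    rw [hsumC, ← sum_bidiag_mul_bidiagMinor a b hl]
    refine Finset.sum_congr rfl fun k hk => ?_
    have hk := Nat.lt_succ_iff.1 (Finset.mem_range.1 hk)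
    rw [hsyz l hl k hk, ← hgen k hk]
  · intro x hx
    rw [hsumC] at hx
    obtain ⟨y, hy⟩ := exists_eq_sum_bidiag a b r
      (fun k _ => Finset.prod_ne_zero_iff.2 fun q _ => lin_ne_zero 1 q)
      (fun k hk z hz => by
        rw [prod_range_prod_Ico _ h0 fun l hl => (he l (l + 1) (by omega) (by omega)).le] at hz
        exact dvd_of_dvd_mul_prod_lin _ A _ z hz)
      (fun k => x (cc k)) (by
        rw [← hx]
        refine Finset.sum_congr rfl fun k hk => ?_
        rw [← hgen k (Nat.lt_succ_iff.1 (Finset.mem_range.1 hk))])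
    refine ⟨fun v => ∑ l ∈ Finset.range r, if vv l = v then y l else 0, fun c hc => ?_⟩
    obtain ⟨k, hk, rfl⟩ := hCmem c hc
    rw [hcomb _ k hk, hy k (Nat.lt_succ_iff.2 hk)]
    refine Finset.sum_congr rfl fun l hl => ?_
    rw [Finset.sum_eq_single l, if_pos rfl]
    · intro m hm hml
      exact if_neg fun h => hml (hvinj m (Finset.mem_range.1 hm) l (Finset.mem_range.1 hl) h)
    · exact fun h => absurd hl h
  · intro y hy v hv
    obtain ⟨l, hl, rfl⟩ := hVmem v hv
    refine eq_zero_of_sum_bidiag_eq_zero a b r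
      (fun k _ => Finset.prod_ne_zero_iff.2 fun i _ => lin_ne_zero 0 (A i))
      (fun l => y (vv l)) (fun k hk => ?_) l hl
    have hk := Nat.lt_succ_iff.1 hk
    rw [← hcomb y k hk]
    exact hy _ (hCi ▸ Finset.mem_image_of_mem cc (Finset.mem_range.2 (Nat.lt_succ_iff.2 hk)))

end BilinearForms
end PaperMP

namespace PaperMP

/-- the graded minimal free resolution of the ideal of an ACM set of
points of `ℙ^1 × ℙ^1` is `0 → ⊕_{v ∈ V_X} R(-v) → ⊕_{c ∈ C_X} R(-c) → I_X → 0`,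
where `C_X` and `V_X` are computed from `α_X`.  Concretely: there are generators
`Gg c` (`c ∈ C_X`) of `I_X`, with `Gg c` bihomogeneous of degree `c`, and a syzygy
matrix `S` with bihomogeneous entries of degrees `v - c` lying in the maximal ideal
(minimality), whose rows generate the syzygies of the `Gg c` and are independent
(exactness). -/
theorem statement_18 (K : Type) [Field K] [IsAlgClosed K] [CharZero K]
    (X : Set (Pt2 K)) (hX : X.Finite) (t : ℕ) (ht : 0 < t)
    (P : Fin t → Proj1 K) (α : Fin t → ℕ) (hα : IsAlphaLabel K X P α)
    (hACM : IsACM K 2 (fun _ => 1) X)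
    (C V : Finset (ℕ × ℕ))
    (hC : C = insert ((t : ℕ), (0 : ℕ)) (insert ((0 : ℕ), α ⟨0, ht⟩)
      (Finset.image (fun j : Fin t => ((j : ℕ), α j))
        (Finset.univ.filter (fun j : Fin t =>
          0 < (j : ℕ) ∧ α j < α ⟨(j : ℕ) - 1, by have := j.isLt; omega⟩)))))
    (hV : V = insert ((t : ℕ), α ⟨t - 1, by omega⟩)
      (Finset.image (fun j : Fin t => ((j : ℕ), α ⟨(j : ℕ) - 1, by have := j.isLt; omega⟩))
        (Finset.univ.filter (fun j : Fin t =>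
          0 < (j : ℕ) ∧ α j < α ⟨(j : ℕ) - 1, by have := j.isLt; omega⟩)))) :
    ∃ (Gg : ℕ × ℕ → R2 K) (S : ℕ × ℕ → ℕ × ℕ → R2 K),
      (∀ c ∈ C, MvPolynomial.IsWeightedHomogeneous (wt 2 (fun _ => 1)) (Gg c)
        ![c.1, c.2]) ∧
      idealOfSet K 2 (fun _ => 1) X = Ideal.span (Gg '' (C : Set (ℕ × ℕ))) ∧
      (∀ v ∈ V, ∀ c ∈ C, S v c = 0 ∨ (c.1 ≤ v.1 ∧ c.2 ≤ v.2 ∧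
        MvPolynomial.IsWeightedHomogeneous (wt 2 (fun _ => 1)) (S v c)
          ![v.1 - c.1, v.2 - c.2])) ∧
      (∀ v ∈ V, ∀ c ∈ C, S v c ∈ maxIdeal K 2 (fun _ => 1)) ∧
      (∀ v ∈ V, ∑ c ∈ C, S v c * Gg c = 0) ∧
      (∀ a : ℕ × ℕ → R2 K, ∑ c ∈ C, a c * Gg c = 0 →
        ∃ b : ℕ × ℕ → R2 K, ∀ c ∈ C, a c = ∑ v ∈ V, b v * S v c) ∧
      (∀ b : ℕ × ℕ → R2 K, (∀ c ∈ C, ∑ v ∈ V, b v * S v c = 0) →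
        ∀ v ∈ V, b v = 0) := by
  classical
  obtain ⟨hPinj, hPrange, hαcard, hanti⟩ := hα
  obtain ⟨L, hL, hreg⟩ := hACM.1
  have hpt : ∀ Z : Pt2 K, ![Z 0, Z 1] = Z := fun Z => by
    funext l; fin_cases l <;> rfl
  have hinj : ∀ p : Proj1 K, Function.Injective fun q : Proj1 K => (![p, q] : Pt2 K) :=
    fun p q q' h => congrFun h 1
  have hfin : ∀ p : Proj1 K, {q : Proj1 K | (![p, q] : Pt2 K) ∈ X}.Finite := fun p =>
    hX.preimage (hinj p).injOn
  set F : Proj1 K → Finset (Proj1 K) := fun p => (hfin p).toFinset with hF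
  have hmemF : ∀ p q, q ∈ F p ↔ (![p, q] : Pt2 K) ∈ X := fun p q => (hfin p).mem_toFinset
  have hcard : ∀ i, (F (P i)).card = α i := by
    intro i
    rw [hαcard, ← Set.ncard_eq_toFinset_card _ (hfin (P i)),
      ← Set.ncard_image_of_injective _ (hinj (P i))]
    congr 1
    ext Z
    constructor
    · rintro ⟨q, hq, rfl⟩
      exact ⟨hq, rfl⟩
    · rintro ⟨hZ, h0⟩
      refine ⟨Z 1, ?_, ?_⟩
      · rwa [Set.mem_ofPred_eq, ← h0, hpt]
      · simp only [← h0, hpt]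
  have hrange : ∀ Z ∈ X, ∃ i, P i = Z 0 := fun Z hZ => by
    have : Z 0 ∈ Set.range P := hPrange ▸ ⟨Z, hZ, rfl⟩
    exact this
  have hne : ∀ i, (F (P i)).Nonempty := by
    intro i
    have : P i ∈ (fun Z : Pt2 K => Z 0) '' X := hPrange ▸ ⟨i, rfl⟩
    obtain ⟨Z, hZ, h0⟩ := this
    refine ⟨Z 1, (hmemF _ _).2 ?_⟩
    rwa [← h0, hpt]
  have hsub : ∀ i j, i ≤ j → F (P j) ⊆ F (P i) := fun i j hij =>
    fiber_subset_of_card_le (X := X) hL hreg (A := Finset.univ.image P) (S := F)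
      (fun Z => by
        rw [hmemF, hpt]
        refine ⟨fun hZ => ⟨?_, hZ⟩, And.right⟩
        obtain ⟨i, hi⟩ := hrange Z hZ
        exact Finset.mem_image.2 ⟨i, Finset.mem_univ i, hi⟩)
      (Finset.mem_image_of_mem P (Finset.mem_univ i))
      (Finset.mem_image_of_mem P (Finset.mem_univ j))
      (by rw [hcard, hcard]; exact hanti hij)
  set A : ℕ → Proj1 K := fun i => if h : i < t then P ⟨i, h⟩ else P ⟨0, ht⟩ with hA
  set S : ℕ → Finset (Proj1 K) := fun i => if h : i < t then F (P ⟨i, h⟩) else ∅ with hS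
  have hAi : ∀ i (h : i < t), A i = P ⟨i, h⟩ := fun i h => dif_pos h
  have hSi : ∀ i (h : i < t), S i = F (P ⟨i, h⟩) := fun i h => dif_pos h
  have hSt : S t = ∅ := dif_neg (lt_irrefl t)
  have hα' : ∀ i (h : i < t), (S i).card = α ⟨i, h⟩ := fun i h => by rw [hSi i h, hcard]
  have hαpos : ∀ i, 0 < α i := fun i => hcard i ▸ (hne i).card_pos
  refine exists_resolution_of_staircase (A := A) (S := S) (t := t) ?_ ?_ ht ?_ hSt ?_ ?_ ?_
  · intro i hi j hj hij
    rw [hAi i hi, hAi j hj] at hij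
    exact congrArg Fin.val (hPinj hij)
  · intro i j hij
    by_cases hj : j < t
    · rw [hSi j hj, hSi i (hij.trans_lt hj)]
      exact hsub _ _ hij
    · rw [show S j = ∅ from dif_neg hj]
      exact Finset.empty_subset _
  · intro i hi
    rw [hSi i hi]
    exact hne _
  · intro Z
    constructor
    · intro hZ
      obtain ⟨i, hi⟩ := hrange Z hZ
      refine ⟨i, i.2, Z 1, ?_, ?_⟩
      · rwa [hSi i i.2, hmemF, hi, hpt]
      · rw [hAi i i.2, hi, hpt]
    · rintro ⟨i, hi, q, hq, rfl⟩
      rwa [hSi i hi, hmemF, ← hAi i hi] at hq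
  · rintro ⟨i, m⟩
    simp only [hC, Finset.mem_insert, Finset.mem_image, Finset.mem_filter, Finset.mem_univ,
      true_and, Prod.mk.injEq]
    constructor
    · rintro (⟨rfl, rfl⟩ | ⟨rfl, rfl⟩ | ⟨j, ⟨hj0, hj⟩, rfl, rfl⟩)
      · refine ⟨le_rfl, Or.inr ?_, by rw [hSt, Finset.card_empty]⟩
        rw [hSt, Finset.card_empty, hα' _ (by omega)]
        exact hαpos _
      · exact ⟨Nat.zero_le _, Or.inl rfl, (hα' 0 ht).symm⟩
      · refine ⟨j.2.le, Or.inr ?_, (hα' j j.2).symm⟩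
        rwa [hα' j j.2, hα' _ (by omega)]
    · rintro ⟨hi, hs, rfl⟩
      rcases hi.lt_or_eq with hi | rfl
      · rcases Nat.eq_zero_or_pos i with rfl | hi0
        · exact Or.inr (Or.inl ⟨rfl, hα' 0 ht⟩)
        · refine Or.inr (Or.inr ⟨⟨i, hi⟩, ⟨hi0, ?_⟩, rfl, (hα' i hi).symm⟩)
          have := hs.resolve_left hi0.ne'
          rwa [hα' i hi, hα' _ (by omega)] at this
      · exact Or.inl ⟨rfl, by rw [hSt, Finset.card_empty]⟩
  · rintro ⟨i, m⟩
    simp only [hV, Finset.mem_insert, Finset.mem_image, Finset.mem_filter, Finset.mem_univ,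
      true_and, Prod.mk.injEq]
    constructor
    · rintro (⟨rfl, rfl⟩ | ⟨j, ⟨hj0, hj⟩, rfl, rfl⟩)
      · refine ⟨le_rfl, ⟨ht, ?_⟩, (hα' _ _).symm⟩
        rw [hSt, Finset.card_empty, hα' _ (by omega)]
        exact hαpos _
      · refine ⟨j.2.le, ⟨hj0, ?_⟩, (hα' _ _).symm⟩
        rwa [hα' j j.2, hα' _ (by omega)]
    · rintro ⟨hi, ⟨hi0, hs⟩, rfl⟩
      rcases hi.lt_or_eq with hi | rfl
      · refine Or.inr ⟨⟨i, hi⟩, ⟨hi0, ?_⟩, rfl, (hα' _ _).symm⟩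
        rwa [hα' i hi, hα' _ (by omega)] at hs
      · exact Or.inl ⟨rfl, hα' _ _⟩

end PaperMP
end
end
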